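/- arXiv:1511.04106 — 3 statements merged into one kernel-verified Lean document; each statement's English description precedes it below -/
import Mathlib

section
/- For every k ≥ 1, the limit i(∞,k) = lim_{n→∞} i(n,k) exists, and i(∞,k) = ∑_{(m_1,…,m_k)} ∏_{j=1}^{k} e^{-1/j}·(1/j)^{m_j}/m_j!, where the (convergent) sum is over all vectors (m_1,…,m_k) ∈ ℕ^k such that the partition (1^{m_1},…,k^{m_k}) has a subpartition of size k. -/
/-- The partition with `m j` parts of size `(j:ℕ)+1` for `j : Fin k` has a subpartition of
size `s`. -/
def HasSubpartitionFin (k : ℕ) (m : Fin k → ℕ) (s : ℕ) : Prop :=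
  ∃ c : Fin k → ℕ, (∀ j, c j ≤ m j) ∧ ∑ j : Fin k, ((j : ℕ) + 1) * c j = s

/-- `fixProp n k` is the proportion `i(n,k)` of permutations of `{1,…,n}` that fix at least
one `k`-element subset setwise. -/
noncomputable def fixProp (n k : ℕ) : ℝ :=
  (Nat.card {π : Equiv.Perm (Fin n) //
      ∃ S : Finset (Fin n), S.card = k ∧ S.image π = S} : ℝ) / (Nat.factorial n : ℝ)

section Aux
open Finset

lemma aux_hasSum_pi (k : ℕ) (f : Fin k → ℕ → ℝ) (a : Fin k → ℝ)
    (hs : ∀ j, Summable fun i => ‖f j i‖) (h : ∀ j, HasSum (f j) (a j)) :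
    (Summable fun m : Fin k → ℕ => ‖∏ j, f j (m j)‖) ∧
    HasSum (fun m : Fin k → ℕ => ∏ j, f j (m j)) (∏ j, a j) := by
  induction k with
  | zero =>
    refine ⟨Summable.of_finite, ?_⟩
    simp
  | succ k ih =>
    obtain ⟨h1, h2⟩ := ih (fun j => f j.succ) (fun j => a j.succ) (fun j => hs _) (fun j => h _)
    have hc : ∀ p : ℕ × (Fin k → ℕ), ∏ j, f j (Fin.consEquiv (fun _ : Fin (k+1) => ℕ) p j) =
        f 0 p.1 * ∏ j : Fin k, f j.succ (p.2 j) := by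
      rintro ⟨x, y⟩
      rw [Fin.prod_univ_succ]
      simp [Fin.consEquiv]
    constructor
    · rw [← (Fin.consEquiv (fun _ : Fin (k+1) => ℕ)).summable_iff]
      have := (hs 0).mul_norm h1
      refine this.congr ?_
      intro p
      simp only [Function.comp_apply]
      rw [hc]
    · rw [← (Fin.consEquiv (fun _ : Fin (k+1) => ℕ)).hasSum_iff]
      have hsm : Summable fun p : ℕ × (Fin k → ℕ) => f 0 p.1 * ∏ j : Fin k, f j.succ (p.2 j) :=
        summable_mul_of_summable_norm (f := f 0)
          (g := fun m : Fin k → ℕ => ∏ j : Fin k, f j.succ (m j)) (hs 0) h1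
      have := HasSum.mul (h 0) h2 hsm
      rw [Fin.prod_univ_succ]
      have he : ((fun m : Fin (k+1) → ℕ => ∏ j, f j (m j)) ∘
          (Fin.consEquiv (fun _ : Fin (k+1) => ℕ))) =
          fun p : ℕ × (Fin k → ℕ) => f 0 p.1 * ∏ j : Fin k, f j.succ (p.2 j) := by
        funext p
        exact hc p
      rw [he]
      exact this

lemma aux_exp_hasSum (x : ℝ) : (Summable fun i : ℕ => ‖x ^ i / (i.factorial : ℝ)‖) ∧
    HasSum (fun i : ℕ => x ^ i / (i.factorial : ℝ)) (Real.exp x) := by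
  constructor
  · exact (NormedSpace.norm_expSeries_div_summable x)
  · rw [Real.exp_eq_exp_ℝ]
    exact NormedSpace.expSeries_div_hasSum_exp x

lemma aux_indicator (c m N : ℕ) (h : c < N) :
    ∑ s ∈ range N, (-1 : ℝ) ^ s * ((m + s).choose m) * (c.choose (m + s)) =
      if c = m then 1 else 0 := by
  rcases lt_or_ge c m with hc | hc
  · rw [if_neg (by omega)]
    apply Finset.sum_eq_zero
    intro s _
    rw [Nat.choose_eq_zero_of_lt (show c < m + s by omega)]
    simp
  · have h1 : ∀ s ∈ range N, (-1 : ℝ) ^ s * ((m + s).choose m) * (c.choose (m + s)) =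
        c.choose m * ((-1 : ℝ) ^ s * ((c - m).choose s)) := by
      intro s _
      rcases lt_or_ge c (m + s) with hcs | hcs
      · rw [Nat.choose_eq_zero_of_lt hcs, Nat.choose_eq_zero_of_lt (show c - m < s by omega)]
        simp
      · have := Nat.choose_mul (n := c) (k := m + s) (s := m) (by omega)
        rw [Nat.add_sub_cancel_left] at this
        have h2 : (c.choose (m+s) : ℝ) * ((m+s).choose m) = c.choose m * (c-m).choose s := by
          exact_mod_cast this
        linear_combination (-1 : ℝ) ^ s * h2
    rw [Finset.sum_congr rfl h1, ← Finset.mul_sum]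
    have h3 : ∑ s ∈ range N, (-1 : ℝ) ^ s * ((c - m).choose s) =
        ∑ s ∈ range (c - m + 1), (-1 : ℝ) ^ s * ((c - m).choose s) := by
      symm
      apply Finset.sum_subset
      · intro x; simp; omega
      · intro x _ hx
        rw [Nat.choose_eq_zero_of_lt (by simpa using hx)]
        simp
    have h4 := Int.alternating_sum_range_choose (n := c - m)
    have h5 : ∑ s ∈ range (c - m + 1), (-1 : ℝ) ^ s * ((c - m).choose s) =
       if c - m = 0 then 1 else 0 := by exact_mod_cast h4
    rw [h3, h5]
    by_cases hcm : c = m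
    · subst hcm; simp
    · rw [if_neg hcm, if_neg (by omega)]; simp

/-- multiset of cycle lengths including fixed points -/
def ppart {n : ℕ} (π : Equiv.Perm (Fin n)) : Multiset ℕ :=
  π.cycleType + Multiset.replicate (n - π.support.card) 1

/-- partitions of n as multisets -/
noncomputable def PN (n : ℕ) : Finset (Multiset ℕ) :=
  (univ : Finset (Nat.Partition n)).image Nat.Partition.parts

lemma mem_PN {n : ℕ} {l : Multiset ℕ} : l ∈ PN n ↔ l.sum = n ∧ ∀ a ∈ l, 0 < a := by
  simp only [PN, Finset.mem_image, Finset.mem_univ, true_and]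
  constructor
  · rintro ⟨p, rfl⟩
    exact ⟨p.parts_sum, fun a ha => p.parts_pos ha⟩
  · rintro ⟨h1, h2⟩
    exact ⟨⟨l, fun {a} ha => h2 a ha, h1⟩, rfl⟩

noncomputable def zinv (K : ℕ) (l : Multiset ℕ) : ℝ :=
  ∏ j ∈ range K, (1 / (j : ℝ)) ^ (l.count j) / ((l.count j).factorial : ℝ)

lemma ppart_mem {n : ℕ} (π : Equiv.Perm (Fin n)) : ppart π ∈ PN n := by
  rw [mem_PN]
  have h := π.partition.parts_sum
  have h' : ∀ a ∈ π.partition.parts, 0 < a := fun a ha => π.partition.parts_pos ha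
  rw [Equiv.Perm.parts_partition] at h h'
  simp only [Fintype.card_fin] at h h'
  exact ⟨h, h'⟩

lemma ppart_filter {n : ℕ} (π : Equiv.Perm (Fin n)) :
    (ppart π).filter (2 ≤ ·) = π.cycleType := by
  have := Equiv.Perm.filter_parts_partition_eq_cycleType (σ := π)
  rw [Equiv.Perm.parts_partition] at this
  simpa [ppart] using this

lemma split_ones {l : Multiset ℕ} (hl : ∀ a ∈ l, 0 < a) :
    l = l.filter (2 ≤ ·) + Multiset.replicate (l.count 1) 1 := by
  ext a
  rw [Multiset.count_add, Multiset.count_filter, Multiset.count_replicate]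
  rcases Nat.lt_trichotomy a 1 with h | h | h
  · have : a = 0 := by omega
    subst this
    have : (0:ℕ) ∉ l := fun h => absurd (hl 0 h) (by omega)
    simp [this]
  · subst h; simp
  · rw [if_pos (by omega), if_neg (by omega)]; simp

lemma ppart_eq_iff {n : ℕ} (π : Equiv.Perm (Fin n)) {l : Multiset ℕ} (hl : l ∈ PN n) :
    ppart π = l ↔ π.cycleType = l.filter (2 ≤ ·) := by
  constructor
  · rintro rfl; rw [ppart_filter]
  · intro h
    have h1 := (mem_PN.1 (ppart_mem π))
    have h2 := (mem_PN.1 hl)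
    rw [← ppart_filter] at h
    have e1 := split_ones h1.2
    have e2 := split_ones h2.2
    have s1 := congrArg Multiset.sum e1
    have s2 := congrArg Multiset.sum e2
    rw [Multiset.sum_add, h1.1] at s1
    rw [Multiset.sum_add, h2.1] at s2
    simp only [Multiset.sum_replicate, smul_eq_mul, mul_one, h] at s1 s2
    rw [e1, e2, h, show Multiset.count 1 (ppart π) = Multiset.count 1 l by omega]

lemma card_ppart {n K : ℕ} (hK : n < K) {l : Multiset ℕ} (hl : l ∈ PN n) :
    ((univ.filter fun π : Equiv.Perm (Fin n) => ppart π = l).card : ℝ) =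
      n.factorial * zinv K l := by
  have h2 := mem_PN.1 hl
  simp_rw [ppart_eq_iff _ hl]
  have h := Equiv.Perm.card_of_cycleType_mul_eq (Fin n) (l.filter (2 ≤ ·))
  have e2 := split_ones h2.2
  have s2 := congrArg Multiset.sum e2
  rw [Multiset.sum_add, h2.1] at s2
  simp only [Multiset.sum_replicate, smul_eq_mul, mul_one] at s2
  rw [Fintype.card_fin, if_pos ⟨by omega, by simp⟩,
    show n - (l.filter (2 ≤ ·)).sum = l.count 1 by omega] at h
  have hz : (l.count 1).factorial * (l.filter (2 ≤ ·)).prod *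
      (∏ i ∈ (l.filter (2 ≤ ·)).toFinset, ((l.filter (2 ≤ ·)).count i).factorial) =
      ∏ j ∈ range K, j ^ (l.count j) * (l.count j).factorial := by
    have hsub : ∀ i ∈ (l.filter (2 ≤ ·)).toFinset, i ∈ (range K).erase 1 := by
      intro i hi
      simp only [Multiset.mem_toFinset, Multiset.mem_filter] at hi
      have := Multiset.single_le_sum (fun _ _ => Nat.zero_le _) i hi.1
      rw [h2.1] at this
      simp only [Finset.mem_erase, Finset.mem_range]; omega
    rw [Finset.prod_multiset_count, mul_assoc, ← Finset.prod_mul_distrib]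
    rw [Finset.prod_subset (s₂ := (range K).erase 1) hsub]
    · rcases Nat.lt_or_ge 1 K with h1 | h1
      · rw [← Finset.mul_prod_erase (range K) _ (a := 1) (by simpa using h1)]
        simp only [one_pow, one_mul]
        congr 1
        apply Finset.prod_congr rfl
        intro x hx
        simp only [Finset.mem_erase, Finset.mem_range] at hx
        rcases Nat.eq_zero_or_pos x with h0 | h0
        · subst h0
          have : (0:ℕ) ∉ l := fun h => absurd (h2.2 0 h) (by omega)
          simp [this]
        · rw [Multiset.count_filter, if_pos (by omega)]
      · have hK1 : K = 1 := by omega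
        have hn : n = 0 := by omega
        subst hK1 hn
        have : l = 0 := by
          rw [Multiset.eq_zero_iff_forall_notMem]
          intro a ha
          have := Multiset.single_le_sum (fun _ _ => Nat.zero_le _) a ha
          have := h2.2 a ha
          omega
        subst this
        simp
    · intro x _ hx
      simp only [Multiset.mem_toFinset] at hx
      rw [Multiset.count_eq_zero_of_notMem hx]; simp
  rw [hz] at h
  have hp : (∏ j ∈ range K, j ^ (l.count j) * (l.count j).factorial) ≠ 0 := by
    rw [Finset.prod_ne_zero_iff]
    intro a _
    refine mul_ne_zero ?_ (Nat.factorial_ne_zero _)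
    rcases Nat.eq_zero_or_pos a with h0 | h0
    · subst h0
      have : (0:ℕ) ∉ l := fun h => absurd (h2.2 0 h) (by omega)
      simp [this]
    · positivity
  have hzi : zinv K l = ((∏ j ∈ range K, j ^ (l.count j) * (l.count j).factorial : ℕ) : ℝ)⁻¹ := by
    rw [zinv]; push_cast; rw [← Finset.prod_inv_distrib]
    apply Finset.prod_congr rfl
    intro x _
    rw [mul_inv, one_div, inv_pow, div_eq_mul_inv]
  rw [hzi, ← h]
  push_cast
  rw [mul_assoc, mul_inv_cancel₀, mul_one]
  exact_mod_cast hp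

lemma expect {n K : ℕ} (hK : n < K) (F : Multiset ℕ → ℝ) :
    (∑ π : Equiv.Perm (Fin n), F (ppart π)) = n.factorial * ∑ l ∈ PN n, F l * zinv K l := by
  rw [← Finset.sum_fiberwise_of_maps_to (s := univ) (t := PN n) (g := ppart)
    (fun π _ => ppart_mem π), Finset.mul_sum]
  apply Finset.sum_congr rfl
  intro l hl
  rw [Finset.sum_congr rfl (g := fun _ => F l) (by intro x hx; rw [(Finset.mem_filter.1 hx).2])]
  rw [Finset.sum_const, nsmul_eq_mul, card_ppart hK hl]
  ring

lemma sum_zinv {n K : ℕ} (hK : n < K) : ∑ l ∈ PN n, zinv K l = 1 := by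
  have := expect hK (fun _ => 1)
  simp only [Finset.sum_const, Finset.card_univ, Fintype.card_perm, Fintype.card_fin,
    nsmul_eq_mul, mul_one, one_mul] at this
  have h : (n.factorial : ℝ) ≠ 0 := by positivity
  exact (mul_left_cancel₀ h (by rw [← this, mul_one]))

noncomputable def bino (K : ℕ) (l R : Multiset ℕ) : ℝ :=
  ∏ j ∈ range K, ((l.count j).choose (R.count j) : ℝ)

lemma bino_zinv_add (K : ℕ) (R l : Multiset ℕ) :
    bino K (R + l) R * zinv K (R + l) = zinv K R * zinv K l := by
  simp only [bino, zinv, ← Finset.prod_mul_distrib]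
  apply Finset.prod_congr rfl
  intro j _
  rw [Multiset.count_add]
  set a := R.count j
  set b := l.count j
  have := Nat.add_choose_mul_factorial_mul_factorial a b
  have h : ((a+b).choose a : ℝ) * a.factorial * b.factorial = (a+b).factorial := by
    rw [Nat.choose_symm_add]; exact_mod_cast this
  rw [← h, pow_add]
  have : ((a+b).choose a : ℝ) ≠ 0 := by
    exact_mod_cast (Nat.choose_pos (Nat.le_add_right a b)).ne'
  field_simp

lemma bino_zero {K : ℕ} {l R : Multiset ℕ} (hR : ∀ a ∈ R, a < K) (h : ¬ R ≤ l) :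
    bino K l R = 0 := by
  rw [Multiset.le_iff_count] at h
  push Not at h
  obtain ⟨a, ha⟩ := h
  have : a ∈ R := Multiset.count_pos.1 (by omega)
  exact Finset.prod_eq_zero (Finset.mem_range.2 (hR a this))
    (by rw [Nat.choose_eq_zero_of_lt ha]; simp)

lemma moment {n K : ℕ} (hK : n < K) (R : Multiset ℕ) (hR : ∀ a ∈ R, 0 < a ∧ a < K) :
    (∑ π : Equiv.Perm (Fin n), bino K (ppart π) R) =
      n.factorial * if R.sum ≤ n then zinv K R else 0 := by
  rw [expect hK (fun l => bino K l R)]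
  congr 1
  split_ifs with h
  · rw [← mul_one (zinv K R), ← sum_zinv (n := n - R.sum) (K := K) (by omega), Finset.mul_sum]
    symm
    apply Finset.sum_of_injOn (fun l => R + l)
    · intro x _ y _ h; simpa using h
    · intro x hx
      rw [Finset.mem_coe, mem_PN] at hx ⊢
      refine ⟨by rw [Multiset.sum_add]; omega, fun a ha => ?_⟩
      rcases Multiset.mem_add.1 ha with h | h
      · exact (hR a h).1
      · exact hx.2 a h
    · intro l hl hl'
      rw [bino_zero (fun a ha => (hR a ha).2), zero_mul]
      intro hle
      apply hl'
      refine ⟨l - R, ?_, by simp [add_tsub_cancel_of_le hle]⟩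
      rw [Finset.mem_coe, mem_PN]
      rw [mem_PN] at hl
      have := congrArg Multiset.sum (add_tsub_cancel_of_le hle)
      rw [Multiset.sum_add, hl.1] at this
      exact ⟨by omega, fun a ha => hl.2 a (Multiset.mem_of_le tsub_le_self ha)⟩
    · intro l _
      exact (bino_zinv_add K R l).symm
  · apply Finset.sum_eq_zero
    intro l hl
    rw [bino_zero (fun a ha => (hR a ha).2), zero_mul]
    intro hle
    have := congrArg Multiset.sum (add_tsub_cancel_of_le hle)
    rw [Multiset.sum_add, (mem_PN.1 hl).1] at this
    omega

lemma sameCycle_iff_fix {n : ℕ} {π : Equiv.Perm (Fin n)} {x y : Fin n} (hx : π x = x) :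
    π.SameCycle x y ↔ y = x := by
  constructor
  · rintro ⟨i, hi⟩
    rw [← hi]
    exact Equiv.Perm.zpow_apply_eq_self_of_apply_eq_self hx i
  · rintro rfl; exact Equiv.Perm.SameCycle.refl _ _

/-- the orbits -/
def orbs {n : ℕ} (π : Equiv.Perm (Fin n)) : Finset (Finset (Fin n)) :=
  π.cycleFactorsFinset.image Equiv.Perm.support ∪ (π.supportᶜ).image (fun x => {x})

lemma orbs_eq {n : ℕ} {π : Equiv.Perm (Fin n)} {B : Finset (Fin n)} (hB : B ∈ orbs π)
    {x : Fin n} (hx : x ∈ B) : B = univ.filter (fun y => π.SameCycle x y) := by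
  simp only [orbs, Finset.mem_union, Finset.mem_image] at hB
  rcases hB with ⟨c, hc, rfl⟩ | ⟨y, hy, rfl⟩
  · have h := Equiv.Perm.cycle_is_cycleOf hx hc
    ext y
    have hxs : x ∈ π.support := Equiv.Perm.mem_cycleFactorsFinset_support_le hc hx
    rw [h, Equiv.Perm.mem_support_cycleOf_iff]
    simp [hxs]
  · simp only [Finset.mem_singleton] at hx
    subst hx
    have : π x = x := by simpa using hy
    ext z
    simp [sameCycle_iff_fix this]

lemma orbs_nonempty {n : ℕ} {π : Equiv.Perm (Fin n)} {B : Finset (Fin n)} (hB : B ∈ orbs π) :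
    B.Nonempty := by
  simp only [orbs, Finset.mem_union, Finset.mem_image] at hB
  rcases hB with ⟨c, hc, rfl⟩ | ⟨y, hy, rfl⟩
  · have := (Equiv.Perm.mem_cycleFactorsFinset_iff.1 hc).1.two_le_card_support
    exact Finset.card_pos.1 (by omega)
  · simp

lemma orbs_cover {n : ℕ} (π : Equiv.Perm (Fin n)) (x : Fin n) : ∃ B ∈ orbs π, x ∈ B := by
  by_cases h : x ∈ π.support
  · refine ⟨(π.cycleOf x).support, ?_, ?_⟩
    · simp only [orbs, Finset.mem_union, Finset.mem_image]
      exact Or.inl ⟨_, Equiv.Perm.cycleOf_mem_cycleFactorsFinset_iff.2 h, rfl⟩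
    · rw [Equiv.Perm.mem_support_cycleOf_iff]
      exact ⟨Equiv.Perm.SameCycle.refl _ _, h⟩
  · refine ⟨{x}, ?_, by simp⟩
    simp only [orbs, Finset.mem_union, Finset.mem_image]
    exact Or.inr ⟨x, by simpa using h, rfl⟩

lemma orbs_disj {n : ℕ} {π : Equiv.Perm (Fin n)} {B C : Finset (Fin n)} (hB : B ∈ orbs π)
    (hC : C ∈ orbs π) (h : B ≠ C) : Disjoint B C := by
  rw [Finset.disjoint_left]
  intro x hx hx'
  exact h ((orbs_eq hB hx).trans (orbs_eq hC hx').symm)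

lemma orbs_map {n : ℕ} (π : Equiv.Perm (Fin n)) : (orbs π).val.map Finset.card = ppart π := by
  have hd : Disjoint (π.cycleFactorsFinset.image Equiv.Perm.support)
      ((π.supportᶜ).image (fun x => ({x} : Finset (Fin n)))) := by
    rw [Finset.disjoint_left]
    intro B hB hB'
    simp only [Finset.mem_image] at hB hB'
    obtain ⟨c, hc, rfl⟩ := hB
    obtain ⟨y, hy, hy'⟩ := hB'
    have := (Equiv.Perm.mem_cycleFactorsFinset_iff.1 hc).1.two_le_card_support
    rw [← hy', Finset.card_singleton] at this
    omega
  rw [orbs, ← Finset.disjUnion_eq_union _ _ hd, Finset.disjUnion_val, Multiset.map_add,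
    Finset.image_val_of_injOn, Finset.image_val_of_injOn, Multiset.map_map, Multiset.map_map]
  · rw [ppart, Equiv.Perm.cycleType_def]
    congr 1
    simp only [Function.comp_def, Finset.card_singleton, Multiset.map_const']
    congr 1
    rw [← Finset.card_def, Finset.card_compl, Fintype.card_fin]
  · intro x _ y _ h; simpa using h
  · intro c hc d hd h
    have h2 := (Equiv.Perm.mem_cycleFactorsFinset_iff.1 hc).1.two_le_card_support
    obtain ⟨x, hx⟩ := Finset.card_pos.1 (show 0 < c.support.card by omega)
    rw [Equiv.Perm.cycle_is_cycleOf hx hc]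
    rw [h] at hx
    rw [Equiv.Perm.cycle_is_cycleOf hx hd]

lemma count_ppart {n : ℕ} (π : Equiv.Perm (Fin n)) (j : ℕ) :
    (ppart π).count j = ((orbs π).filter (fun B => B.card = j)).card := by
  rw [← orbs_map, Multiset.count_map]
  simp only [eq_comm (a := j)]
  rfl

lemma inv_sameCycle {n : ℕ} {π : Equiv.Perm (Fin n)} {S : Finset (Fin n)} (hS : S.image π = S)
    {x y : Fin n} (hx : x ∈ S) (h : π.SameCycle x y) : y ∈ S := by
  obtain ⟨i, _, _, rfl⟩ := h.exists_pow_eq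
  clear h
  rename_i h1 h2
  clear h1 h2
  induction i with
  | zero => simpa
  | succ i ih =>
    rw [pow_succ', Equiv.Perm.mul_apply, ← hS]
    exact Finset.mem_image_of_mem _ ih

lemma fixes_iff {n k : ℕ} (π : Equiv.Perm (Fin n)) :
    (∃ S : Finset (Fin n), S.card = k ∧ S.image π = S) ↔
      HasSubpartitionFin k (fun j => (ppart π).count ((j : ℕ) + 1)) k := by
  constructor
  · rintro ⟨S, hk, hS⟩
    set T := (orbs π).filter (fun B => B ⊆ S) with hT
    have hST : S = T.biUnion id := by
      ext x
      simp only [Finset.mem_biUnion, id]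
      constructor
      · intro hx
        obtain ⟨B, hB, hxB⟩ := orbs_cover π x
        refine ⟨B, ?_, hxB⟩
        rw [hT, Finset.mem_filter]
        refine ⟨hB, fun y hy => ?_⟩
        rw [orbs_eq hB hxB] at hy
        exact inv_sameCycle hS hx (by simpa using hy)
      · rintro ⟨B, hB, hxB⟩
        exact (Finset.mem_filter.1 hB).2 hxB
    have hcard : S.card = ∑ B ∈ T, B.card := by
      conv_lhs => rw [hST]
      rw [Finset.card_biUnion]
      · rfl
      · intro B hB C hC h
        exact orbs_disj (Finset.mem_filter.1 hB).1 (Finset.mem_filter.1 hC).1 h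
    refine ⟨fun j => (T.filter (fun B => B.card = (j : ℕ) + 1)).card, ?_, ?_⟩
    · intro j
      simp only
      rw [count_ppart]
      exact Finset.card_le_card (Finset.filter_subset_filter _ (Finset.filter_subset _ _))
    · refine Eq.trans ?_ (hcard.symm.trans hk)
      have hm : ∀ B ∈ T, B.card ∈ (univ : Finset (Fin k)).image (fun j : Fin k => (j : ℕ) + 1) := by
        intro B hB
        have h1 := Finset.card_pos.2 (orbs_nonempty (Finset.mem_filter.1 hB).1)
        have h2 := Finset.card_le_card (Finset.mem_filter.1 hB).2
        rw [hk] at h2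
        exact Finset.mem_image.2 ⟨⟨B.card - 1, by omega⟩, Finset.mem_univ _, by simp only; omega⟩
      rw [← Finset.sum_fiberwise_of_maps_to hm, Finset.sum_image]
      · apply Finset.sum_congr rfl
        intro j _
        rw [Finset.sum_congr rfl (g := fun _ => (j : ℕ) + 1)
          (by intro x hx; exact (Finset.mem_filter.1 hx).2)]
        rw [Finset.sum_const, smul_eq_mul, mul_comm]
      · intro a _ b _ h
        exact Fin.ext (by simpa using h)
  · rintro ⟨c, hc, hsum⟩
    have hex : ∀ j : Fin k, ∃ T ⊆ (orbs π).filter (fun B => B.card = (j : ℕ) + 1),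
        T.card = c j := by
      intro j
      apply Finset.exists_subset_card_eq
      rw [← count_ppart]
      exact hc j
    choose T hT hTc using hex
    have hmem : ∀ j, ∀ B ∈ T j, B ∈ orbs π ∧ B.card = j + 1 := fun j B hB =>
      Finset.mem_filter.1 (hT j hB)
    refine ⟨(univ : Finset (Fin k)).biUnion (fun j => (T j).biUnion id), ?_, ?_⟩
    · rw [Finset.card_biUnion]
      · refine Eq.trans ?_ hsum
        apply Finset.sum_congr rfl
        intro j _
        rw [Finset.card_biUnion]
        · rw [Finset.sum_congr rfl (g := fun _ => (j : ℕ) + 1)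
            (by intro x hx; exact (hmem j x hx).2)]
          rw [Finset.sum_const, smul_eq_mul, mul_comm, hTc]
        · intro B hB C hC h
          exact orbs_disj (hmem j B hB).1 (hmem j C hC).1 h
      · intro i _ j _ hij
        change Disjoint ((T i).biUnion id) ((T j).biUnion id)
        rw [Finset.disjoint_biUnion_left]
        intro B hB
        rw [Finset.disjoint_biUnion_right]
        intro C hC
        refine orbs_disj (hmem i B hB).1 (hmem j C hC).1 ?_
        rintro rfl
        have h1 := (hmem i B hB).2
        have h2 := (hmem j B hC).2
        exact hij (Fin.ext (by omega))
    · apply Finset.eq_of_subset_of_card_le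
      · intro y hy
        rw [Finset.mem_image] at hy
        obtain ⟨x, hx, rfl⟩ := hy
        simp only [Finset.mem_biUnion, Finset.mem_univ, true_and, id] at hx ⊢
        obtain ⟨j, B, hB, hxB⟩ := hx
        refine ⟨j, B, hB, ?_⟩
        rw [orbs_eq (hmem j B hB).1 hxB]
        simp [Equiv.Perm.SameCycle.refl]
      · rw [Finset.card_image_of_injective _ π.injective]

noncomputable def wt (k : ℕ) (m : Fin k → ℕ) : ℝ :=
  ∏ j : Fin k, (1 / ((j : ℕ) + 1 : ℝ)) ^ (m j) / ((m j).factorial : ℝ)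

def sz (k : ℕ) (m : Fin k → ℕ) : ℕ := ∑ j : Fin k, ((j : ℕ) + 1) * m j

def mkR (k : ℕ) (m : Fin k → ℕ) : Multiset ℕ :=
  ∑ j : Fin k, Multiset.replicate (m j) ((j : ℕ) + 1)

lemma count_mkR (k : ℕ) (m : Fin k → ℕ) (i : ℕ) :
    (mkR k m).count i = ∑ j : Fin k, if (j : ℕ) + 1 = i then m j else 0 := by
  rw [mkR, Multiset.count_sum']
  simp only [Multiset.count_replicate]

lemma count_mkR_succ (k : ℕ) (m : Fin k → ℕ) (j : Fin k) :
    (mkR k m).count ((j : ℕ) + 1) = m j := by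
  rw [count_mkR, Finset.sum_eq_single j]
  · simp
  · intro b _ hb
    rw [if_neg]
    intro h; exact hb (Fin.ext (by omega))
  · simp

lemma count_mkR_zero (k : ℕ) (m : Fin k → ℕ) (i : ℕ) (hi : i = 0 ∨ k < i) :
    (mkR k m).count i = 0 := by
  rw [count_mkR]
  apply Finset.sum_eq_zero
  intro j _
  rw [if_neg]
  have := j.2
  omega

lemma sum_mkR (k : ℕ) (m : Fin k → ℕ) : (mkR k m).sum = sz k m := by
  rw [mkR, Multiset.sum_sum, sz]
  apply Finset.sum_congr rfl
  intro j _
  rw [Multiset.sum_replicate, smul_eq_mul, mul_comm]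

lemma prod_range_fin (n k : ℕ) (f : ℕ → ℝ) (hf : ∀ i, (i = 0 ∨ k < i) → f i = 1) :
    ∏ i ∈ range (n + k + 1), f i = ∏ j : Fin k, f ((j : ℕ) + 1) := by
  rw [Finset.prod_range_succ', hf 0 (Or.inl rfl), mul_one,
    Fin.prod_univ_eq_prod_range (fun i => f (i + 1)) k]
  symm
  apply Finset.prod_subset
  · intro x; simp only [Finset.mem_range]; omega
  · intro x _ hx
    apply hf
    simp only [Finset.mem_range] at hx
    omega

lemma moment' (n k : ℕ) (m : Fin k → ℕ) :
    (∑ π : Equiv.Perm (Fin n), ∏ j : Fin k,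
        (((ppart π).count ((j : ℕ) + 1)).choose (m j) : ℝ)) =
      n.factorial * if sz k m ≤ n then wt k m else 0 := by
  have h := moment (n := n) (K := n + k + 1) (by omega) (mkR k m) (by
    intro a ha
    by_contra hcon
    have := count_mkR_zero k m a (by omega)
    exact (Multiset.count_eq_zero.1 this) ha)
  rw [sum_mkR] at h
  have h1 : zinv (n + k + 1) (mkR k m) = wt k m := by
    rw [zinv, prod_range_fin, wt]
    · apply Finset.prod_congr rfl
      intro j _
      rw [count_mkR_succ]; push_cast; rfl
    · intro i hi
      rw [count_mkR_zero k m i hi]; simp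
  have h2 : ∀ l, bino (n + k + 1) l (mkR k m) = ∏ j : Fin k,
        ((l.count ((j : ℕ) + 1)).choose (m j) : ℝ) := by
    intro l
    rw [bino, prod_range_fin]
    · apply Finset.prod_congr rfl
      intro j _
      rw [count_mkR_succ]
    · intro i hi
      rw [count_mkR_zero k m i hi]; simp
  rw [h1] at h
  simp only [h2] at h
  exact h

/-- counts of small cycles -/
def cnt {n : ℕ} (k : ℕ) (π : Equiv.Perm (Fin n)) : Fin k → ℕ :=
  fun j => (ppart π).count ((j : ℕ) + 1)

lemma cnt_le {n : ℕ} (k : ℕ) (π : Equiv.Perm (Fin n)) (j : Fin k) : cnt k π j ≤ n := by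
  rw [cnt, count_ppart]
  have h := (mem_PN.1 (ppart_mem π)).1
  rw [← orbs_map] at h
  calc _ ≤ (orbs π).card := Finset.card_filter_le _ _
    _ = ∑ B ∈ orbs π, 1 := by simp
    _ ≤ ∑ B ∈ orbs π, B.card :=
      Finset.sum_le_sum fun B hB => Finset.card_pos.2 (orbs_nonempty hB)
    _ = n := h

noncomputable def PP (n k : ℕ) (m : Fin k → ℕ) : ℝ :=
  ((univ.filter fun π : Equiv.Perm (Fin n) => cnt k π = m).card : ℝ) / n.factorial

lemma ind_eq {n k : ℕ} (π : Equiv.Perm (Fin n)) (m : Fin k → ℕ) :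
    (if cnt k π = m then (1:ℝ) else 0) = ∏ j, if cnt k π j = m j then (1:ℝ) else 0 := by
  split_ifs with h
  · subst h; simp
  · have : ∃ j, cnt k π j ≠ m j := by
      by_contra hc; push Not at hc; exact h (funext hc)
    obtain ⟨j, hj⟩ := this
    exact (Finset.prod_eq_zero (Finset.mem_univ j) (by simp [hj])).symm

lemma PP_eq_sum (n k : ℕ) (m : Fin k → ℕ) :
    PP n k m = (∑ π : Equiv.Perm (Fin n), ∏ j, if cnt k π j = m j then (1:ℝ) else 0)
      / n.factorial := by
  rw [PP, Finset.card_filter]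
  push_cast
  simp only [ind_eq]

lemma PP_nonneg (n k : ℕ) (m : Fin k → ℕ) : 0 ≤ PP n k m := by
  rw [PP]; positivity

lemma wt_nonneg (k : ℕ) (m : Fin k → ℕ) : 0 ≤ wt k m := by
  rw [wt]; positivity

lemma PP_le (n k : ℕ) (m : Fin k → ℕ) : PP n k m ≤ wt k m := by
  rw [PP_eq_sum, div_le_iff₀ (by positivity)]
  calc _ ≤ ∑ π : Equiv.Perm (Fin n), ∏ j : Fin k,
        (((ppart π).count ((j : ℕ) + 1)).choose (m j) : ℝ) := by
        apply Finset.sum_le_sum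
        intro π _
        apply Finset.prod_le_prod
        · intro j _; split_ifs <;> simp
        · intro j _
          split_ifs with h
          · rw [← h]; simp [cnt]
          · positivity
    _ ≤ _ := by
        rw [moment', mul_comm]
        apply mul_le_mul_of_nonneg_right _ (by positivity)
        split_ifs
        · exact le_rfl
        · exact wt_nonneg k m

/-- signed weight -/
noncomputable def sw (k : ℕ) (s : Fin k → ℕ) : ℝ :=
  ∏ j : Fin k, (-(1 / ((j : ℕ) + 1 : ℝ))) ^ (s j) / ((s j).factorial : ℝ)

lemma wt_add (k : ℕ) (m s : Fin k → ℕ) :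
    (∏ j, (-1 : ℝ) ^ (s j) * ((m j + s j).choose (m j))) * wt k (m + s) = wt k m * sw k s := by
  simp only [wt, sw, ← Finset.prod_mul_distrib]
  apply Finset.prod_congr rfl
  intro j _
  rw [Pi.add_apply]
  set a := m j
  set b := s j
  have := Nat.add_choose_mul_factorial_mul_factorial a b
  have h : ((a+b).choose a : ℝ) * a.factorial * b.factorial = (a+b).factorial := by
    rw [Nat.choose_symm_add]; exact_mod_cast this
  rw [← h, pow_add, neg_pow (1 / ((j : ℕ) + 1 : ℝ)) b]
  have : ((a+b).choose a : ℝ) ≠ 0 := by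
    exact_mod_cast (Nat.choose_pos (Nat.le_add_right a b)).ne'
  field_simp

lemma sz_add (k : ℕ) (m s : Fin k → ℕ) : sz k (m + s) = sz k m + sz k s := by
  simp only [sz, Pi.add_apply, mul_add, Finset.sum_add_distrib]

lemma le_sz (k : ℕ) (s : Fin k → ℕ) (j : Fin k) : s j ≤ sz k s := by
  have := Finset.single_le_sum (f := fun j : Fin k => ((j : ℕ) + 1) * s j)
    (fun _ _ => Nat.zero_le _) (Finset.mem_univ j)
  calc s j ≤ ((j : ℕ) + 1) * s j := Nat.le_mul_of_pos_left _ (by omega)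
    _ ≤ _ := this

lemma PP_tsum (n k : ℕ) (m : Fin k → ℕ) :
    PP n k m = ∑' s : Fin k → ℕ, if sz k m + sz k s ≤ n then wt k m * sw k s else 0 := by
  rw [tsum_eq_sum (s := Fintype.piFinset (fun _ : Fin k => range (n + 1)))]
  · rw [PP_eq_sum, div_eq_iff (by positivity)]
    have h1 : ∀ π : Equiv.Perm (Fin n), (∏ j, if cnt k π j = m j then (1:ℝ) else 0) =
        ∑ s ∈ Fintype.piFinset (fun _ : Fin k => range (n + 1)),
          (∏ j, (-1 : ℝ) ^ (s j) * ((m j + s j).choose (m j))) *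
            ∏ j : Fin k, (((ppart π).count ((j : ℕ) + 1)).choose ((m + s) j) : ℝ) := by
      intro π
      rw [Finset.prod_congr rfl (fun j _ => (aux_indicator (cnt k π j) (m j) (n + 1)
        (Nat.lt_succ_of_le (cnt_le k π j))).symm), Finset.prod_univ_sum]
      apply Finset.sum_congr rfl
      intro s _
      rw [← Finset.prod_mul_distrib]
      rfl
    simp only [h1]
    rw [Finset.sum_comm, Finset.sum_mul]
    apply Finset.sum_congr rfl
    intro s _
    rw [← Finset.mul_sum, moment', sz_add]
    split_ifs
    · rw [← wt_add]; ring
    · ring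
  · intro s hs
    rw [if_neg]
    intro h
    apply hs
    rw [Fintype.mem_piFinset]
    intro j
    have := le_sz k s j
    rw [Finset.mem_range]
    omega

lemma sw_sum (k : ℕ) : (Summable fun s : Fin k → ℕ => ‖sw k s‖) ∧
    HasSum (sw k) (∏ j : Fin k, Real.exp (-(1 / ((j : ℕ) + 1 : ℝ)))) :=
  aux_hasSum_pi k (fun j i => (-(1 / ((j : ℕ) + 1 : ℝ))) ^ i / (i.factorial : ℝ)) _
    (fun _ => (aux_exp_hasSum _).1) (fun _ => (aux_exp_hasSum _).2)

lemma wt_summable (k : ℕ) : Summable (wt k) :=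
  (aux_hasSum_pi k (fun j i => ((1 / ((j : ℕ) + 1 : ℝ))) ^ i / (i.factorial : ℝ))
    (fun j => Real.exp (1 / ((j : ℕ) + 1 : ℝ)))
    (fun _ => (aux_exp_hasSum _).1) (fun _ => (aux_exp_hasSum _).2)).2.summable

lemma PP_tendsto (k : ℕ) (m : Fin k → ℕ) :
    Filter.Tendsto (fun n => PP n k m) Filter.atTop
      (nhds (wt k m * ∏ j : Fin k, Real.exp (-(1 / ((j : ℕ) + 1 : ℝ))))) := by
  simp only [PP_tsum]
  rw [← (sw_sum k).2.tsum_eq, ← tsum_mul_left]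
  apply tendsto_tsum_of_dominated_convergence (bound := fun s => wt k m * ‖sw k s‖)
  · exact (sw_sum k).1.mul_left _
  · intro s
    apply tendsto_const_nhds.congr'
    filter_upwards [Filter.eventually_ge_atTop (sz k m + sz k s)] with n hn
    rw [if_pos hn]
  · refine Filter.Eventually.of_forall fun n s => ?_
    split_ifs
    · rw [norm_mul, Real.norm_of_nonneg (wt_nonneg k m)]
    · rw [norm_zero]
      exact mul_nonneg (wt_nonneg k m) (norm_nonneg _)

lemma fixProp_eq (n k : ℕ) :
    fixProp n k = ∑' m : {m : Fin k → ℕ // HasSubpartitionFin k m k}, PP n k m.1 := by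
  classical
  refine Eq.trans ?_
    (tsum_subtype (s := {m : Fin k → ℕ | HasSubpartitionFin k m k}) (f := PP n k)).symm
  have hc : ∀ π : Equiv.Perm (Fin n), cnt k π ∈ Fintype.piFinset (fun _ : Fin k => range (n + 1)) :=
    fun π => Fintype.mem_piFinset.2 fun j =>
      Finset.mem_range.2 (Nat.lt_succ_of_le (cnt_le k π j))
  rw [tsum_eq_sum (s := Fintype.piFinset (fun _ : Fin k => range (n + 1)))]
  · rw [fixProp]
    simp only [fixes_iff]
    rw [Nat.card_eq_fintype_card, Fintype.card_subtype,
      Finset.card_eq_sum_card_fiberwise (f := cnt k)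
        (t := Fintype.piFinset (fun _ : Fin k => range (n + 1))) (fun π _ => hc π)]
    push_cast
    rw [Finset.sum_div]
    apply Finset.sum_congr rfl
    intro m _
    rw [Set.indicator_apply]
    split_ifs with h
    · rw [PP, Finset.filter_filter]
      congr 3
      ext π
      simp only [Finset.mem_filter, Finset.mem_univ, true_and, and_iff_right_iff_imp]
      rintro rfl
      exact h
    · rw [Finset.filter_filter, Finset.filter_false_of_mem]
      · simp
      · rintro π _ ⟨h1, rfl⟩
        exact h h1
  · intro m hm
    rw [Set.indicator_apply]
    split_ifs
    · rw [PP, Finset.filter_false_of_mem]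
      · simp
      · rintro π _ rfl
        exact hm (hc π)
    · rfl

end Aux

/-- For every `k ≥ 1` the limit `i(∞,k) = lim_{n→∞} i(n,k)` exists, and equals the convergent
sum of `∏_{j=1}^{k} e^{-1/j}·(1/j)^{m_j}/m_j!` over all `(m_1,…,m_k) ∈ ℕ^k` whose partition
`(1^{m_1},…,k^{m_k})` has a subpartition of size `k`. -/
theorem fixProp_tendsto (k : ℕ) (hk : 1 ≤ k) :
    Summable (fun m : {m : Fin k → ℕ // HasSubpartitionFin k m k} =>
      ∏ j : Fin k, Real.exp (-(1 / ((j : ℕ) + 1 : ℝ))) * (1 / ((j : ℕ) + 1 : ℝ)) ^ (m.1 j) /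
        (Nat.factorial (m.1 j) : ℝ)) ∧
    Filter.Tendsto (fun n => fixProp n k) Filter.atTop
      (nhds (∑' m : {m : Fin k → ℕ // HasSubpartitionFin k m k},
        ∏ j : Fin k, Real.exp (-(1 / ((j : ℕ) + 1 : ℝ))) * (1 / ((j : ℕ) + 1 : ℝ)) ^ (m.1 j) /
          (Nat.factorial (m.1 j) : ℝ))) := by
  have hterm : ∀ m : Fin k → ℕ, (∏ j : Fin k, Real.exp (-(1 / ((j : ℕ) + 1 : ℝ))) *
      (1 / ((j : ℕ) + 1 : ℝ)) ^ (m j) / (Nat.factorial (m j) : ℝ)) =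
      wt k m * ∏ j : Fin k, Real.exp (-(1 / ((j : ℕ) + 1 : ℝ))) := by
    intro m
    rw [wt, ← Finset.prod_mul_distrib]
    apply Finset.prod_congr rfl
    intro j _
    ring
  simp only [hterm]
  have hws : Summable fun m : {m : Fin k → ℕ // HasSubpartitionFin k m k} => wt k m.1 :=
    (wt_summable k).comp_injective Subtype.val_injective
  refine ⟨hws.mul_right _, ?_⟩
  simp only [fixProp_eq]
  apply tendsto_tsum_of_dominated_convergence hws
  · intro m
    exact PP_tendsto k m.1
  · refine Filter.Eventually.of_forall fun n m => ?_
    rw [Real.norm_of_nonneg (PP_nonneg n k m.1)]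
    exact PP_le n k m.1
end

section
/- For every integer k with 1 ≤ k ≤ 29, p(∞,k) < p(∞,k+1); equivalently, i(∞,k) > i(∞,k+1) for 1 ≤ k ≤ 29, so that i(∞,k) is strictly decreasing for k ≤ 30 (verifying Cameron's conjecture in this range). -/
/-- `pInf k = p(∞,k)`: the convergent sum of `∏_{j=1}^{k} e^{-1/j}·(1/j)^{m_j}/m_j!` over all
`k`-free multiplicity vectors `(m_1,…,m_k) ∈ ℕ^k`. -/
noncomputable def pInf (k : ℕ) : ℝ :=
  ∑' m : {m : Fin k → ℕ // ¬ HasSubpartitionFin k m k},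
    ∏ j : Fin k, Real.exp (-(1 / ((j : ℕ) + 1 : ℝ))) * (1 / ((j : ℕ) + 1 : ℝ)) ^ (m.1 j) /
      (Nat.factorial (m.1 j) : ℝ)


/-- Search trees storing pairs (key, weight). -/
inductive WTree : Type
  | leaf : WTree
  | node : ℕ → ℕ → WTree → WTree → WTree
  | bin : ℕ → WTree → WTree → WTree

namespace PInf

/-- Evaluate a natural number before passing it on (helps kernel reduction). -/
noncomputable def force {R : Type} (n : ℕ) (f : ℕ → R) : R :=
  @Nat.rec (fun _ => R) (f 0) (fun m _ => f (Nat.succ m)) n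

/-- Insertion of weight `w` at key `K` (with hash `h`), continuation passing style. -/
noncomputable def insK {R : Type} (K h w : ℕ) (t : WTree) : (WTree → R) → R :=
  @WTree.rec (fun _ => (WTree → R) → R)
    (fun c => c (WTree.node K w WTree.leaf WTree.leaf))
    (fun K' w' l r ihl ihr c =>
      @Bool.rec (fun _ => R)
        (@Bool.rec (fun _ => R)
          (ihr (fun r' => c (WTree.node K' w' l r')))
          (ihl (fun l' => c (WTree.node K' w' l' r)))
          (Nat.ble K K'))
        (force (Nat.add w w') (fun w'' => c (WTree.node K' w'' l r)))
        (Nat.beq K K'))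
    (fun s l r ihl ihr c =>
      @Bool.rec (fun _ => R)
        (ihr (fun r' => c (WTree.bin s l r')))
        (ihl (fun l' => c (WTree.bin s l' r)))
        (Nat.ble h s))
    t

/-- Sum of a list. -/
noncomputable def lsum (l : List ℕ) : ℕ :=
  @List.rec ℕ (fun _ => ℕ) 0 (fun a _ ih => Nat.add a ih) l

/-- Distribute the weight `w` of the state `T` over the number of new parts. -/
noncomputable def loopK {R : Type} (P J M KK w : ℕ) (qs : List ℕ) :
    ℕ → ℕ → WTree → (ℕ → WTree → R) → R :=
  @List.rec ℕ (fun _ => ℕ → ℕ → WTree → (ℕ → WTree → R) → R)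
    (fun _ h t c => c h t)
    (fun q qs ih T h t c =>
      @Bool.rec (fun _ => R)
        (force (Nat.lor T (Nat.mod (Nat.mul T J) M)) (fun T' =>
          force (Nat.mod T KK) (fun U =>
          @Bool.rec (fun _ => R)
            (force (Nat.div (Nat.mul w q) 4294967296) (fun v =>
                insK U (Nat.mod U 1021) v t (fun t' => ih T' h t' c)))
            (force (Nat.div (Nat.mul w (lsum (q :: qs))) 4294967296) (fun v =>
                insK U (Nat.mod U 1021) v t (fun t' => c h t')))
            (Nat.beq T' T))))
        (force (Nat.add h (Nat.div (Nat.mul w (lsum (q :: qs))) 4294967296)) (fun h' => c h' t))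
        (Nat.ble P T))
    qs

/-- Process all states of a tree. -/
noncomputable def foldK {R : Type} (P J M KK : ℕ) (qs : List ℕ) (s : WTree) :
    ℕ → WTree → (ℕ → WTree → R) → R :=
  @WTree.rec (fun _ => ℕ → WTree → (ℕ → WTree → R) → R)
    (fun h t c => c h t)
    (fun K w _ _ ihl ihr h t c =>
      loopK P J M KK w qs K h t (fun h' t' => ihl h' t' (fun h'' t'' => ihr h'' t'' c)))
    (fun _ _ _ ihl ihr h t c => ihl h t (fun h'' t'' => ihr h'' t'' c))
    s

/-- A balanced tree of depth `d` without weights. -/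
noncomputable def skelK {R : Type} (d : ℕ) : ℕ → ℕ → (WTree → R) → R :=
  @Nat.rec (fun _ => ℕ → ℕ → (WTree → R) → R)
    (fun _ _ c => c WTree.leaf)
    (fun _ ih b a c =>
      force (Nat.div a 2) (fun a' =>
      force (Nat.add b a) (fun b' =>
      force (Nat.pred b') (fun s =>
        ih b a' (fun l => ih b' a' (fun r => c (WTree.bin s l r)))))))
    d

/-- Process the parts `j+1, j+2, …, j+n` where `k = j + n`. -/
noncomputable def runK {R : Type} (k : ℕ) (rows : List (List ℕ)) :
    ℕ → ℕ → WTree → (ℕ → WTree → R) → R :=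
  @List.rec (List ℕ) (fun _ => ℕ → ℕ → WTree → (ℕ → WTree → R) → R)
    (fun _ h t c => c h t)
    (fun qs _ ih j h t c =>
      force (Nat.succ j) (fun j' =>
      force (Nat.pow 2 k) (fun P =>
      force (Nat.pow 2 j') (fun J =>
      force (Nat.pow 2 (Nat.succ k)) (fun M =>
      force (Nat.pow 2 (Nat.sub k j')) (fun KK =>
      skelK (Nat.sub (Nat.div k 3) (Nat.add (Nat.sub (Nat.div k 3) j') (Nat.sub (Nat.div k 3) (Nat.sub k j')))) 0 512 (fun t0 =>
        foldK P J M KK qs t h t0 (fun h' t' => ih j' h' t' c))))))))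
    rows

/-- Weight at the root. -/
noncomputable def rootW (t : WTree) : ℕ :=
  @WTree.rec (fun _ => ℕ) 0 (fun _ w _ _ _ _ => w) (fun _ _ _ _ _ => 0) t

/-- The whole computation. -/
noncomputable def solveK {R : Type} (k : ℕ) (rows : List (List ℕ)) (c : ℕ → ℕ → R) : R :=
  runK k rows 0 0 (WTree.node 1 4294967296 WTree.leaf WTree.leaf) (fun h t => c h (rootW t))

def poisTable : List (List ℕ) :=
  [[1580030168, 1580030168, 790015084, 263338361, 65834590, 13166918, 2194486, 313498, 39187, 4354, 435],
   [2605029347, 1302514673, 325628668, 54271444, 6783930, 678393, 56532, 4038, 252],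
   [3077478545, 1025826181, 170971030, 18996781, 1583065, 105537, 5863, 279],
   [3344923893, 836230973, 104528871, 8710739, 544421, 27221, 1134],
   [3516421808, 703284361, 70328436, 4688562, 234428, 9377, 312],
   [3635611325, 605935220, 50494601, 2805255, 116885, 3896, 108],
   [3723212229, 531887461, 37991961, 1809141, 64612, 1846],
   [3790295335, 473786916, 29611682, 1233820, 38556, 963],
   [3843305600, 427033955, 23724108, 878670, 24407, 542],
   [3886247118, 388624711, 19431235, 647707, 16192, 323],
   [3921737714, 356521610, 16205527, 491076, 11160, 202],
   [3951560671, 329296722, 13720696, 381130, 7940, 132],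
   [3976972550, 305920965, 11766190, 301697, 5801, 89],
   [3998884189, 285634584, 10201235, 242886, 4337],
   [4017971905, 267864793, 8928826, 198418, 3306],
   [4034748382, 252171773, 7880367, 164174, 2565],
   [4049609317, 238212312, 7006244, 137377, 2020],
   [4062864982, 225714721, 6269853, 116108, 1612],
   [4074762089, 214461162, 5643714, 99012, 1302],
   [4085499269, 204274963, 5106874, 85114, 1063],
   [4095238237, 195011344, 4643127, 73700, 877],
   [4104111990, 186550545, 4239785, 64239, 729],
   [4112230903, 178792647, 3886796, 56330, 612],
   [4119687348, 171653639, 3576117, 49668, 517],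
   [4126559219, 165062368, 3301247, 44016, 440],
   [4132912658, 158958179, 3056888, 39190, 376],
   [4138804193, 153289044, 2838686, 35045, 324],
   [4144282424, 148010086, 2643037, 31464, 280],
   [4149389364, 143082391, 2466937, 28355, 244],
   [4154161519, 138472050, 2307867, 25642, 213]]

/-! ### Semantics -/

open scoped ENNReal

/-- Poisson weight of `m` parts of size `i + 1`. -/
noncomputable def pois (i m : ℕ) : ℝ≥0∞ :=
  ENNReal.ofReal (Real.exp (-(1 / ((i : ℕ) + 1 : ℝ))) * (1 / ((i : ℕ) + 1 : ℝ)) ^ m /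
      (Nat.factorial m : ℝ))

/-- Starting from the sums in `A`, the parts `j+1, …, j+n` allow to reach `k`. -/
def Reach (k n j : ℕ) (A : ℕ → Prop) (m : Fin n → ℕ) : Prop :=
  ∃ s, A s ∧ ∃ c : Fin n → ℕ, (∀ i, c i ≤ m i) ∧ s + ∑ i : Fin n, (j + i + 1) * c i = k

/-- Expected value of `χ (Reach …)`. -/
noncomputable def phi (χ : Prop → ℝ≥0∞) (k n j : ℕ) (A : ℕ → Prop) : ℝ≥0∞ :=
  ∑' m : Fin n → ℕ, χ (Reach k n j A m) * ∏ i : Fin n, pois (j + i) (m i)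

/-- Adding up to `m` parts of size `d`. -/
def addParts (d m : ℕ) (A : ℕ → Prop) (s : ℕ) : Prop :=
  ∃ a c, A a ∧ c ≤ m ∧ s = a + c * d

theorem reach_cons (k n j : ℕ) (A : ℕ → Prop) (m0 : ℕ) (m : Fin n → ℕ) :
    Reach k (n + 1) j A (Fin.cons m0 m) ↔ Reach k n (j + 1) (addParts (j + 1) m0 A) m := by
  constructor
  · rintro ⟨s, hs, c, hc, hk⟩
    refine ⟨s + c 0 * (j + 1), ⟨s, c 0, hs, by simpa using hc 0, rfl⟩, fun i => c i.succ,
      fun i => by simpa using hc i.succ, ?_⟩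
    rw [Fin.sum_univ_succ] at hk
    rw [← hk, add_assoc]
    congr 1
    simp only [Fin.val_zero, Fin.val_succ]
    congr 1
    · ring
    · exact Finset.sum_congr rfl fun i _ => by ring
  · rintro ⟨_, ⟨s, c0, hs, hc0, rfl⟩, c, hc, hk⟩
    refine ⟨s, hs, Fin.cons c0 c, ?_, ?_⟩
    · intro i
      refine Fin.cases ?_ (fun i => ?_) i
      · simpa using hc0
      · simpa using hc i
    · rw [Fin.sum_univ_succ, ← hk, add_assoc s]
      congr 1
      simp only [Fin.val_zero, Fin.val_succ, Fin.cons_zero, Fin.cons_succ]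
      congr 1
      · ring
      · exact Finset.sum_congr rfl fun i _ => by ring

theorem phi_succ (χ : Prop → ℝ≥0∞) (k n j : ℕ) (A : ℕ → Prop) :
    phi χ k (n + 1) j A = ∑' m0, pois j m0 * phi χ k n (j + 1) (addParts (j + 1) m0 A) := by
  unfold phi
  rw [← (Fin.consEquiv (fun _ : Fin (n + 1) => ℕ)).tsum_eq, ENNReal.tsum_prod']
  refine tsum_congr fun m0 => ?_
  rw [← ENNReal.tsum_mul_left]
  refine tsum_congr fun m => ?_
  have h1 : (Fin.consEquiv (fun _ : Fin (n + 1) => ℕ)) (m0, m) = Fin.cons m0 m := rfl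
  rw [h1, propext (reach_cons k n j A m0 m), Fin.prod_univ_succ]
  simp only [Fin.cons_zero, Fin.cons_succ, Fin.val_zero, Fin.val_succ, add_zero]
  have h2 : ∀ i : Fin n, pois (j + (↑i + 1)) (m i) = pois (j + 1 + ↑i) (m i) := by
    intro i
    congr 1
    ring
  rw [Finset.prod_congr rfl fun i _ => h2 i]
  ring

theorem tsum_pois (j : ℕ) : ∑' m, pois j m = 1 := by
  unfold pois
  have hs := (NormedSpace.expSeries_div_hasSum_exp (𝔸 := ℝ) (1 / ((j : ℕ) + 1 : ℝ))).mul_left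
    (Real.exp (-(1 / ((j : ℕ) + 1 : ℝ))))
  rw [← Real.exp_eq_exp_ℝ, ← Real.exp_add] at hs
  simp only [neg_add_cancel, Real.exp_zero, ← mul_div_assoc] at hs
  rw [← ENNReal.ofReal_tsum_of_nonneg, hs.tsum_eq, ENNReal.ofReal_one]
  · intro m
    positivity
  · exact hs.summable

theorem phi_one (k n j : ℕ) (A : ℕ → Prop) : phi (fun _ => 1) k n j A = 1 := by
  induction n generalizing j A with
  | zero => simp [phi]
  | succ n ih => simp [phi_succ, ih, tsum_pois]

theorem phi_congr (χ : Prop → ℝ≥0∞) (k n j : ℕ) (A B : ℕ → Prop)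
    (hk : A k ↔ B k) (hs : ∀ s, s + (j + 1) ≤ k → (A s ↔ B s)) :
    phi χ k n j A = phi χ k n j B := by
  unfold phi
  refine tsum_congr fun m => ?_
  have : Reach k n j A m ↔ Reach k n j B m := by
    unfold Reach
    refine exists_congr fun s => ?_
    refine and_congr_left ?_
    rintro ⟨c, -, hc⟩
    by_cases h0 : ∀ i, c i = 0
    · have : s = k := by simpa [h0] using hc
      rw [this, hk]
    · push Not at h0
      obtain ⟨i, hi⟩ := h0
      apply hs
      have h1 : (j + i + 1) * c i ≤ ∑ i : Fin n, (j + i + 1) * c i :=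
        Finset.single_le_sum (f := fun i : Fin n => (j + i + 1) * c i)
          (fun _ _ => Nat.zero_le _) (Finset.mem_univ i)
      have h2 : (j + i + 1) * 1 ≤ (j + i + 1) * c i :=
        Nat.mul_le_mul_left _ (Nat.one_le_iff_ne_zero.mpr hi)
      omega
  rw [propext this]

theorem phi_hit (χ : Prop → ℝ≥0∞) (k n j : ℕ) (A : ℕ → Prop) (hk : A k) :
    phi χ k n j A = χ True := by
  have h1 : ∀ m : Fin n → ℕ, Reach k n j A m = True := fun m =>
    eq_true ⟨k, hk, fun _ => 0, fun _ => Nat.zero_le _, by simp⟩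
  have h2 := phi_one k n j A
  unfold phi at h2 ⊢
  simp only [one_mul] at h2
  simp only [h1]
  rw [ENNReal.tsum_mul_left, h2, mul_one]

theorem phi_zero (χ : Prop → ℝ≥0∞) (k j : ℕ) (A : ℕ → Prop) :
    phi χ k 0 j A = χ (A k) := by
  have : ∀ m, Reach k 0 j A m = A k := fun m => by simp [Reach]
  simp [phi, this]

/-- The sums stored in a bit mask. -/
def bits (T : ℕ) (s : ℕ) : Prop := T.testBit s = true

/-- Adding one more part. -/
def sh (J M T : ℕ) : ℕ := Nat.lor T (Nat.mod (Nat.mul T J) M)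

theorem bits_sh (k d T s : ℕ) (hs : s ≤ k) :
    bits (sh (2 ^ d) (2 ^ (k + 1)) T) s ↔ (bits T s ∨ (d ≤ s ∧ bits T (s - d))) := by
  have : sh (2 ^ d) (2 ^ (k + 1)) T = T ||| ((T * 2 ^ d) % 2 ^ (k + 1)) := rfl
  unfold bits
  rw [this, Nat.testBit_or, Nat.testBit_mod_two_pow, Nat.testBit_mul_two_pow]
  simp only [Bool.or_eq_true, Bool.and_eq_true, decide_eq_true_eq]
  constructor
  · rintro (h | ⟨_, h⟩)
    · exact Or.inl h
    · exact Or.inr h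
  · rintro (h | h)
    · exact Or.inl h
    · exact Or.inr ⟨by omega, h⟩

theorem bits_iterate (k d T m s : ℕ) (hs : s ≤ k) :
    bits ((sh (2 ^ d) (2 ^ (k + 1)))^[m] T) s ↔ addParts d m (bits T) s := by
  induction m generalizing s with
  | zero =>
    simp only [Function.iterate_zero, id]
    constructor
    · intro h
      exact ⟨s, 0, h, le_refl _, by simp⟩
    · rintro ⟨a, c, ha, hc, rfl⟩
      obtain rfl : c = 0 := by omega
      simpa using ha
  | succ m ih =>
    rw [Function.iterate_succ_apply', bits_sh _ _ _ _ hs, ih s hs, ih (s - d) (by omega)]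
    constructor
    · rintro (⟨a, c, ha, hc, rfl⟩ | ⟨hd, a, c, ha, hc, he⟩)
      · exact ⟨a, c, ha, by omega, rfl⟩
      · refine ⟨a, c + 1, ha, by omega, ?_⟩
        rw [add_mul]
        omega
    · rintro ⟨a, c, ha, hc, rfl⟩
      rcases Nat.lt_or_ge m c with h | h
      · obtain rfl : c = m + 1 := by omega
        right
        rw [add_mul]
        exact ⟨by omega, a, m, ha, le_refl _, by omega⟩
      · exact Or.inl ⟨a, c, ha, h, rfl⟩

theorem phi_step (χ : Prop → ℝ≥0∞) (k n j T : ℕ) :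
    phi χ k (n + 1) j (bits T) = ∑' m, pois j m *
      phi χ k n (j + 1) (bits ((sh (2 ^ (j + 1)) (2 ^ (k + 1)))^[m] T)) := by
  rw [phi_succ]
  refine tsum_congr fun m => ?_
  congr 1
  refine phi_congr _ _ _ _ _ _ ?_ ?_
  · rw [bits_iterate _ _ _ _ _ le_rfl]
  · intro s hs
    rw [bits_iterate _ _ _ _ _ (by omega)]

theorem phi_mod (χ : Prop → ℝ≥0∞) (k n j T : ℕ) (hT : T < 2 ^ k) :
    phi χ k n j (bits (T % 2 ^ (k - j))) = phi χ k n j (bits T) := by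
  refine phi_congr _ _ _ _ _ _ ?_ ?_
  · have h1 : T.testBit k = false := Nat.testBit_lt_two_pow hT
    simp [bits, Nat.testBit_mod_two_pow, h1]
  · intro s hs
    have : s < k - j := by omega
    simp [bits, Nat.testBit_mod_two_pow, this]

theorem phi_ge (χ : Prop → ℝ≥0∞) (k n j T : ℕ) (h1 : 2 ^ k ≤ T) (h2 : T < 2 ^ (k + 1)) :
    phi χ k n j (bits T) = χ True := by
  apply phi_hit
  unfold bits
  rw [Nat.testBit_eq_decide_div_mod_eq]
  have : T / 2 ^ k = 1 := by
    apply Nat.div_eq_of_lt_le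
    · simpa using h1
    · rw [pow_succ] at h2
      omega
  simp [this]

/-! ### The frozen quantity -/

theorem pInf_eq (k : ℕ) :
    pInf k = (phi (fun P => open Classical in if P then 0 else 1) k k 0 (bits 1)).toReal := by
  classical
  unfold pInf phi
  rw [ENNReal.tsum_toReal_eq]
  · have hR : ∀ m : Fin k → ℕ, Reach k k 0 (bits 1) m ↔ HasSubpartitionFin k m k := by
      intro m
      unfold Reach HasSubpartitionFin
      constructor
      · rintro ⟨s, hs, c, hc, hk⟩
        have : s = 0 := by
          unfold bits at hs
          by_contra h
          rw [Nat.testBit_one_eq_true_iff_self_eq_zero] at hs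
          exact h hs
        subst this
        exact ⟨c, hc, by simpa using hk⟩
      · rintro ⟨c, hc, hk⟩
        exact ⟨0, by simp [bits], c, hc, by simpa using hk⟩
    refine (tsum_subtype (s := {m : Fin k → ℕ | ¬ HasSubpartitionFin k m k})
      (f := fun m : Fin k → ℕ => ∏ j : Fin k,
        Real.exp (-(1 / ((j : ℕ) + 1 : ℝ))) * (1 / ((j : ℕ) + 1 : ℝ)) ^ (m j) /
          (Nat.factorial (m j) : ℝ))).trans ?_
    refine tsum_congr fun m => ?_
    by_cases h : HasSubpartitionFin k m k
    · simp [Set.indicator, hR, h]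
    · simp only [Set.indicator, Set.mem_ofPred_eq, hR, h, not_false_eq_true, if_true, if_false,
        one_mul, ENNReal.toReal_prod]
      refine Finset.prod_congr rfl fun i _ => ?_
      unfold pois
      rw [zero_add, ENNReal.toReal_ofReal (by positivity)]
  · intro m
    refine ENNReal.mul_ne_top (by beta_reduce; split_ifs <;> simp) ?_
    exact ENNReal.prod_ne_top fun i _ => ENNReal.ofReal_ne_top

theorem phi_compl (k n j : ℕ) (A : ℕ → Prop) :
    phi (fun P => open Classical in if P then 0 else 1) k n j A +
      phi (fun P => open Classical in if P then 1 else 0) k n j A = 1 := by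
  classical
  refine Eq.trans ?_ (phi_one k n j A)
  unfold phi
  rw [← ENNReal.tsum_add]
  refine tsum_congr fun m => ?_
  rw [← add_mul]
  congr 1
  beta_reduce
  split_ifs <;> simp

/-! ### Correctness of the computation -/

/-- Total weight of a tree. -/
noncomputable def val (ψ : ℕ → ℝ≥0∞) : WTree → ℝ≥0∞
  | WTree.leaf => 0
  | WTree.node K w l r => w * ψ K + val ψ l + val ψ r
  | WTree.bin _ l r => val ψ l + val ψ r

/-- All keys are less than `N`. -/
def Bd (N : ℕ) : WTree → Prop
  | WTree.leaf => True
  | WTree.node K _ l r => K < N ∧ Bd N l ∧ Bd N r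
  | WTree.bin _ l r => Bd N l ∧ Bd N r

theorem force_eq {R : Type} (n : ℕ) (f : ℕ → R) : force n f = f n := by
  cases n <;> rfl

theorem insK_spec {R : Type} (K h w : ℕ) (t : WTree) :
    ∃ t', (∀ c : WTree → R, insK K h w t c = c t') ∧
      (∀ N, K < N → Bd N t → Bd N t') ∧ ∀ ψ, val ψ t' = val ψ t + w * ψ K := by
  induction t with
  | leaf =>
    exact ⟨_, fun c => rfl, fun N h _ => ⟨h, trivial, trivial⟩, fun ψ => by simp [val]⟩
  | node K' w' l r ihl ihr =>
    obtain ⟨l', hl1, hl2, hl3⟩ := ihl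
    obtain ⟨r', hr1, hr2, hr3⟩ := ihr
    rcases hb : Nat.beq K K' with _ | _
    · rcases hb2 : Nat.ble K K' with _ | _
      · refine ⟨WTree.node K' w' l r', fun c => ?_, fun N h hB => ⟨hB.1, hB.2.1, hr2 N h hB.2.2⟩,
          fun ψ => ?_⟩
        · rw [← hr1 (fun r' => c (WTree.node K' w' l r'))]
          simp only [insK, hb, hb2]
        · simp only [val, hr3]
          ring
      · refine ⟨WTree.node K' w' l' r, fun c => ?_, fun N h hB => ⟨hB.1, hl2 N h hB.2.1, hB.2.2⟩,
          fun ψ => ?_⟩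
        · rw [← hl1 (fun l' => c (WTree.node K' w' l' r))]
          simp only [insK, hb, hb2]
        · simp only [val, hl3]
          ring
    · refine ⟨WTree.node K' (w + w') l r, fun c => ?_, fun N h hB => hB, fun ψ => ?_⟩
      · simp only [insK, hb, force_eq]
        rfl
      · obtain rfl : K = K' := Nat.eq_of_beq_eq_true hb
        simp only [val]
        push_cast
        ring
  | bin s l r ihl ihr =>
    obtain ⟨l', hl1, hl2, hl3⟩ := ihl
    obtain ⟨r', hr1, hr2, hr3⟩ := ihr
    rcases hb : Nat.ble h s with _ | _
    · refine ⟨WTree.bin s l r', fun c => ?_, fun N h hB => ⟨hB.1, hr2 N h hB.2⟩, fun ψ => ?_⟩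
      · rw [← hr1 (fun r' => c (WTree.bin s l r'))]
        simp only [insK, hb]
      · simp only [val, hr3]
        ring
    · refine ⟨WTree.bin s l' r, fun c => ?_, fun N h hB => ⟨hl2 N h hB.1, hB.2⟩, fun ψ => ?_⟩
      · rw [← hl1 (fun l' => c (WTree.bin s l' r))]
        simp only [insK, hb]
      · simp only [val, hl3]
        ring

/-- The ideal contribution of a state. -/
noncomputable def contrib (J M : ℕ) (ψ : ℕ → ℝ≥0∞) : List ℕ → ℕ → ℝ≥0∞
  | [], _ => 0
  | q :: qs, T => (q : ℝ≥0∞) / 4294967296 * ψ T + contrib J M ψ qs (sh J M T)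

theorem lsum_cons (q : ℕ) (qs : List ℕ) : lsum (q :: qs) = q + lsum qs := rfl

theorem contrib_const (J M : ℕ) (ψ : ℕ → ℝ≥0∞) (e : ℝ≥0∞) (Q : ℕ → Prop)
    (hQ : ∀ T, Q T → Q (sh J M T)) (hψ : ∀ T, Q T → ψ T = e) (qs : List ℕ) (T : ℕ) (hT : Q T) :
    contrib J M ψ qs T = (lsum qs : ℝ≥0∞) / 4294967296 * e := by
  induction qs generalizing T with
  | nil => simp [contrib, lsum]
  | cons q qs ih =>
    rw [contrib, ih _ (hQ T hT), hψ T hT, lsum_cons]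
    push_cast
    rw [ENNReal.add_div, add_mul]

theorem floor_le (w q : ℕ) (x : ℝ≥0∞) :
    ((Nat.div (Nat.mul w q) 4294967296 : ℕ) : ℝ≥0∞) * x ≤
      w * ((q : ℝ≥0∞) / 4294967296 * x) := by
  rw [← mul_assoc, ← mul_div_assoc]
  gcongr
  rw [ENNReal.le_div_iff_mul_le (by simp) (by simp)]
  have : Nat.div (Nat.mul w q) 4294967296 * 4294967296 ≤ w * q := Nat.div_mul_le_self _ _
  exact_mod_cast this

theorem le_sh (J M T : ℕ) : T ≤ sh J M T := Nat.left_le_or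

theorem sh_lt (k d T : ℕ) (hT : T < 2 ^ (k + 1)) : sh (2 ^ d) (2 ^ (k + 1)) T < 2 ^ (k + 1) :=
  Nat.or_lt_two_pow hT (Nat.mod_lt _ (by positivity))

theorem loopK_spec {R : Type} (k j d w : ℕ) (qs : List ℕ) (T h : ℕ) (t : WTree)
    (hT : T < 2 ^ (k + 1)) :
    ∃ h' t', (∀ c : ℕ → WTree → R,
        loopK (2 ^ k) (2 ^ d) (2 ^ (k + 1)) (2 ^ (k - j)) w qs T h t c = c h' t') ∧
      (Bd (2 ^ (k - j)) t → Bd (2 ^ (k - j)) t') ∧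
      ∀ (ψ : ℕ → ℝ≥0∞) (e : ℝ≥0∞),
        (∀ T, T < 2 ^ k → ψ (T % 2 ^ (k - j)) = ψ T) →
        (∀ T, 2 ^ k ≤ T → T < 2 ^ (k + 1) → ψ T = e) →
        h' * e + val ψ t' ≤ h * e + val ψ t +
          w * contrib (2 ^ d) (2 ^ (k + 1)) ψ qs T := by
  induction qs generalizing T h t with
  | nil => exact ⟨h, t, fun c => rfl, id, fun ψ e _ _ => by simp [contrib]⟩
  | cons q qs ih =>
    rcases hb : Nat.ble (2 ^ k) T with _ | _
    · have hlt : T < 2 ^ k := by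
        by_contra hcon
        rw [Nat.ble_eq_true_of_le (not_lt.mp hcon)] at hb
        exact absurd hb (by simp)
      have hU : Nat.mod T (2 ^ (k - j)) < 2 ^ (k - j) := Nat.mod_lt _ (by positivity)
      rcases hb2 : Nat.beq (sh (2 ^ d) (2 ^ (k + 1)) T) T with _ | _
      · obtain ⟨t1, h1, h2, h3⟩ := insK_spec (R := R) (Nat.mod T (2 ^ (k - j)))
          (Nat.mod (Nat.mod T (2 ^ (k - j))) 1021)
          (Nat.div (Nat.mul w q) 4294967296) t
        obtain ⟨h', t', h4, h5, h6⟩ := ih _ h t1 (sh_lt k d T hT)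
        refine ⟨h', t', fun c => ?_, fun hB => h5 (h2 _ hU hB), fun ψ e hp he => ?_⟩
        · rw [← h4 c, ← h1 (fun t' => loopK _ _ _ _ _ qs (sh (2 ^ d) (2 ^ (k + 1)) T) h t' c)]
          unfold sh at hb2
          simp only [loopK, hb, force_eq, hb2, sh]
        · refine (h6 ψ e hp he).trans ?_
          rw [h3, contrib, mul_add]
          have := floor_le w q (ψ (Nat.mod T (2 ^ (k - j))))
          have hm : ψ (Nat.mod T (2 ^ (k - j))) = ψ T := hp T hlt
          rw [hm] at this ⊢
          calc _ ≤ h * e + (val ψ t + w * ((q : ℝ≥0∞) / 4294967296 * ψ T)) + _ := by gcongr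
            _ = _ := by ring
      · obtain ⟨t1, h1, h2, h3⟩ := insK_spec (R := R) (Nat.mod T (2 ^ (k - j)))
          (Nat.mod (Nat.mod T (2 ^ (k - j))) 1021)
          (Nat.div (Nat.mul w (lsum (q :: qs))) 4294967296) t
        refine ⟨h, t1, fun c => ?_, fun hB => h2 _ hU hB, fun ψ e hp he => ?_⟩
        · rw [← h1 (fun t' => c h t')]
          unfold sh at hb2
          simp only [loopK, hb, force_eq, hb2]
        · have hfix : sh (2 ^ d) (2 ^ (k + 1)) T = T := Nat.eq_of_beq_eq_true hb2
          rw [h3, contrib_const _ _ ψ (ψ T) (fun S => S = T) (fun S hS => by rw [hS, hfix])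
            (fun S hS => by rw [hS]) _ _ rfl]
          have := floor_le w (lsum (q :: qs)) (ψ (Nat.mod T (2 ^ (k - j))))
          have hm : ψ (Nat.mod T (2 ^ (k - j))) = ψ T := hp T hlt
          rw [hm] at this ⊢
          rw [← add_assoc]
          gcongr
    · refine ⟨Nat.add h (Nat.div (Nat.mul w (lsum (q :: qs))) 4294967296), t, fun c => ?_, id,
        fun ψ e hp he => ?_⟩
      · simp only [loopK, hb, force_eq]
      · have hge : 2 ^ k ≤ T := Nat.le_of_ble_eq_true hb
        rw [contrib_const _ _ ψ e (fun S => 2 ^ k ≤ S ∧ S < 2 ^ (k + 1))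
          (fun S hS => ⟨hS.1.trans (le_sh _ _ _), sh_lt k d S hS.2⟩)
          (fun S hS => he S hS.1 hS.2) _ _ ⟨hge, hT⟩]
        have := floor_le w (lsum (q :: qs)) e
        have hc : ((Nat.add h (Nat.div (Nat.mul w (lsum (q :: qs))) 4294967296) : ℕ) : ℝ≥0∞) =
          h + (Nat.div (Nat.mul w (lsum (q :: qs))) 4294967296 : ℕ) := Nat.cast_add _ _
        rw [hc, add_mul]
        calc _ ≤ h * e + w * ((lsum (q :: qs) : ℝ≥0∞) / 4294967296 * e) + val ψ t := by gcongr
          _ = _ := by ring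

theorem foldK_spec {R : Type} (k j d : ℕ) (qs : List ℕ) (s : WTree) (hs : Bd (2 ^ (k + 1)) s)
    (h : ℕ) (t : WTree) :
    ∃ h' t', (∀ c : ℕ → WTree → R,
        foldK (2 ^ k) (2 ^ d) (2 ^ (k + 1)) (2 ^ (k - j)) qs s h t c = c h' t') ∧
      (Bd (2 ^ (k - j)) t → Bd (2 ^ (k - j)) t') ∧
      ∀ (ψ : ℕ → ℝ≥0∞) (e : ℝ≥0∞),
        (∀ T, T < 2 ^ k → ψ (T % 2 ^ (k - j)) = ψ T) →
        (∀ T, 2 ^ k ≤ T → T < 2 ^ (k + 1) → ψ T = e) →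
        h' * e + val ψ t' ≤ h * e + val ψ t +
          val (contrib (2 ^ d) (2 ^ (k + 1)) ψ qs) s := by
  induction s generalizing h t with
  | leaf => exact ⟨h, t, fun c => rfl, id, fun ψ e _ _ => by simp [val]⟩
  | node K w l r ihl ihr =>
    obtain ⟨h1, t1, a1, b1, c1⟩ := loopK_spec (R := R) k j d w qs K h t hs.1
    obtain ⟨h2, t2, a2, b2, c2⟩ := ihl hs.2.1 h1 t1
    obtain ⟨h3, t3, a3, b3, c3⟩ := ihr hs.2.2 h2 t2
    refine ⟨h3, t3, fun c => ?_, fun hB => b3 (b2 (b1 hB)), fun ψ e hp he => ?_⟩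
    · rw [← a3 c, ← a2 (fun h'' t'' => foldK _ _ _ _ _ r h'' t'' c),
        ← a1 (fun h' t' => foldK _ _ _ _ _ l h' t' _)]
      rfl
    · have e1 := c1 ψ e hp he
      have e2 := c2 ψ e hp he
      have e3 := c3 ψ e hp he
      refine e3.trans ((add_le_add_left (e2.trans (add_le_add_left e1 _)) _).trans (le_of_eq ?_))
      simp only [val]
      ring
  | bin s l r ihl ihr =>
    obtain ⟨h2, t2, a2, b2, c2⟩ := ihl hs.1 h t
    obtain ⟨h3, t3, a3, b3, c3⟩ := ihr hs.2 h2 t2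
    refine ⟨h3, t3, fun c => ?_, fun hB => b3 (b2 hB), fun ψ e hp he => ?_⟩
    · rw [← a3 c, ← a2 (fun h'' t'' => foldK _ _ _ _ _ r h'' t'' c)]
      rfl
    · have e2 := c2 ψ e hp he
      have e3 := c3 ψ e hp he
      refine e3.trans ((add_le_add_left e2 _).trans (le_of_eq ?_))
      simp only [val]
      ring

theorem skelK_spec {R : Type} (d b a : ℕ) :
    ∃ t', (∀ c : WTree → R, skelK d b a c = c t') ∧ (∀ N, Bd N t') ∧ ∀ ψ, val ψ t' = 0 := by
  induction d generalizing b a with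
  | zero => exact ⟨WTree.leaf, fun c => rfl, fun N => trivial, fun ψ => rfl⟩
  | succ d ih =>
    obtain ⟨l, l1, l2, l3⟩ := ih b (Nat.div a 2)
    obtain ⟨r, r1, r2, r3⟩ := ih (Nat.add b a) (Nat.div a 2)
    refine ⟨WTree.bin (Nat.pred (Nat.add b a)) l r, fun c => ?_, fun N => ⟨l2 N, r2 N⟩,
      fun ψ => by simp [val, l3, r3]⟩
    rw [← r1 (fun r => c (WTree.bin _ l r)), ← l1 (fun l => skelK d _ _ (fun r => c (WTree.bin _ l r)))]
    simp only [skelK, force_eq]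

/-- The entries of a row are lower bounds for Poisson weights. -/
def OkRow (j : ℕ) : ℕ → List ℕ → Prop
  | _, [] => True
  | m, q :: qs => (q : ℝ≥0∞) / 4294967296 ≤ pois j m ∧ OkRow j (m + 1) qs

/-- All rows are fine. -/
def OkRows : ℕ → List (List ℕ) → Prop
  | _, [] => True
  | j, qs :: rows => OkRow j 0 qs ∧ OkRows (j + 1) rows

theorem contrib_le (J M : ℕ) (ψ : ℕ → ℝ≥0∞) (j m : ℕ) (qs : List ℕ) (h : OkRow j m qs) (T : ℕ) :
    contrib J M ψ qs T ≤ ∑' i, pois j (m + i) * ψ ((sh J M)^[i] T) := by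
  induction qs generalizing m T with
  | nil => simp [contrib]
  | cons q qs ih =>
    rw [contrib, tsum_eq_zero_add' ENNReal.summable]
    refine add_le_add ?_ ?_
    · simp only [add_zero, Function.iterate_zero, id]
      gcongr
      exact h.1
    · refine (ih (m + 1) h.2 (sh J M T)).trans (le_of_eq ?_)
      refine tsum_congr fun i => ?_
      rw [Function.iterate_succ_apply]
      congr 2
      ring

theorem val_mono (ψ₁ ψ₂ : ℕ → ℝ≥0∞) (h : ∀ T, ψ₁ T ≤ ψ₂ T) (t : WTree) :
    val ψ₁ t ≤ val ψ₂ t := by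
  induction t with
  | leaf => exact le_rfl
  | node K w l r ihl ihr =>
    simp only [val]
    gcongr
    exact h K
  | bin s l r ihl ihr =>
    simp only [val]
    gcongr

theorem Bd_mono {N N' : ℕ} (h : N ≤ N') (t : WTree) (ht : Bd N t) : Bd N' t := by
  induction t with
  | leaf => trivial
  | node K w l r ihl ihr => exact ⟨ht.1.trans_le h, ihl ht.2.1, ihr ht.2.2⟩
  | bin s l r ihl ihr => exact ⟨ihl ht.1, ihr ht.2⟩

theorem runK_spec {R : Type} (k : ℕ) (rows : List (List ℕ)) (j h : ℕ) (t : WTree)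
    (hj : j + rows.length = k) (hr : OkRows j rows) (ht : Bd (2 ^ (k - j)) t) :
    ∃ h' t', (∀ c : ℕ → WTree → R, runK k rows j h t c = c h' t') ∧ Bd 1 t' ∧
      ∀ χ : Prop → ℝ≥0∞, h' * χ True + val (fun T => phi χ k 0 k (bits T)) t' ≤
        h * χ True + val (fun T => phi χ k rows.length j (bits T)) t := by
  induction rows generalizing j h t with
  | nil =>
    obtain rfl : j = k := by simpa using hj
    exact ⟨h, t, fun c => rfl, by simpa using ht, fun χ => le_rfl⟩
  | cons qs rows ih =>
    rw [List.length_cons] at hj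
    obtain ⟨t0, a0, b0, c0⟩ := skelK_spec (R := R)
      (Nat.sub (Nat.div k 3) (Nat.add (Nat.sub (Nat.div k 3) (Nat.succ j))
        (Nat.sub (Nat.div k 3) (Nat.sub k (Nat.succ j))))) 0 512
    obtain ⟨h1, t1, a1, b1, c1⟩ := foldK_spec (R := R) k (j + 1) (j + 1) qs t
      (Bd_mono (Nat.pow_le_pow_right (by norm_num) (by omega)) t ht) h t0
    obtain ⟨h2, t2, a2, b2, c2⟩ := ih (j + 1) h1 t1 (by omega) hr.2 (b1 (b0 _))
    refine ⟨h2, t2, fun c => ?_, b2, fun χ => (c2 χ).trans ?_⟩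
    · rw [← a2 c, ← a1 (fun h' t' => runK k rows (j + 1) h' t' c),
        ← a0 (fun t0 => foldK _ _ _ _ _ t h t0 _)]
      simp only [runK, force_eq]
      rfl
    · refine (c1 (fun T => phi χ k rows.length (j + 1) (bits T)) (χ True)
        (fun T hT => phi_mod χ k _ (j + 1) T hT)
        (fun T hT1 hT2 => phi_ge χ k _ _ T hT1 hT2)).trans ?_
      rw [c0, add_zero]
      gcongr
      apply val_mono
      intro T
      refine (contrib_le _ _ _ j 0 qs hr.1 T).trans (le_of_eq ?_)
      rw [List.length_cons, phi_step]
      simp only [zero_add]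

theorem rootW_le (χ : Prop → ℝ≥0∞) (k : ℕ) (t : WTree) (ht : Bd 1 t) :
    rootW t * χ False ≤ val (fun T => phi χ k 0 k (bits T)) t := by
  cases t with
  | leaf => simp [rootW]
  | bin s l r => simp [rootW]
  | node K w l r =>
    obtain rfl : K = 0 := by
      have := ht.1
      omega
    have h0 : phi χ k 0 k (bits 0) = χ False := by
      rw [phi_zero]
      simp [bits]
    have : rootW (WTree.node 0 w l r) = w := rfl
    simp only [val, h0, this, add_assoc]
    exact le_self_add

theorem solveK_spec {R : Type} (k : ℕ) (hk : 1 ≤ k) (rows : List (List ℕ))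
    (hlen : rows.length = k) (hr : OkRows 0 rows) :
    ∃ h f, (∀ c : ℕ → ℕ → R, solveK k rows c = c h f) ∧
      ∀ χ : Prop → ℝ≥0∞, h * χ True + f * χ False ≤ 4294967296 * phi χ k k 0 (bits 1) := by
  obtain ⟨h, t, a, b, c⟩ := runK_spec (R := R) k rows 0 0
    (WTree.node 1 4294967296 WTree.leaf WTree.leaf) (by omega) hr
    ⟨Nat.one_lt_two_pow (by omega), trivial, trivial⟩
  refine ⟨h, rootW t, fun c => by simp only [solveK, a], fun χ => ?_⟩
  refine (add_le_add le_rfl (rootW_le χ k t b)).trans ((c χ).trans (le_of_eq ?_))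
  simp [val, hlen]

/-- Certified check of two lower bounds. -/
noncomputable def goodK (k a b : ℕ) (rows : List (List ℕ)) : Bool :=
  solveK k rows (fun h f => and (Nat.ble a h) (Nat.ble b f))

theorem bounds_of_good (k a b : ℕ) (hk : 1 ≤ k) (rows : List (List ℕ))
    (hlen : rows.length = k) (hr : OkRows 0 rows) (hg : goodK k a b rows = true) :
    (b : ℝ) ≤ 4294967296 * pInf k ∧ (a : ℝ) ≤ 4294967296 * (1 - pInf k) := by
  obtain ⟨h, f, e, hχ⟩ := solveK_spec (R := Bool) k hk rows hlen hr
  rw [goodK, e, Bool.and_eq_true] at hg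
  have ha : a ≤ h := Nat.le_of_ble_eq_true hg.1
  have hb : b ≤ f := Nat.le_of_ble_eq_true hg.2
  have h1 := hχ (fun P => open Classical in if P then 0 else 1)
  have h2 := hχ (fun P => open Classical in if P then 1 else 0)
  simp only [if_true, if_false, mul_zero, mul_one, zero_add, add_zero] at h1 h2
  have hsum := phi_compl k k 0 (bits 1)
  rw [pInf_eq]
  set F := phi (fun P => open Classical in if P then 0 else 1) k k 0 (bits 1) with hF
  set H := phi (fun P => open Classical in if P then 1 else 0) k k 0 (bits 1) with hH
  have hFt : F ≠ ⊤ := fun h => by simp [h] at hsum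
  have hHt : H ≠ ⊤ := fun h => by simp [h] at hsum
  have hs' : F.toReal + H.toReal = 1 := by
    rw [← ENNReal.toReal_add hFt hHt, hsum, ENNReal.toReal_one]
  have h1' : (f : ℝ) ≤ 4294967296 * F.toReal := by
    have := ENNReal.toReal_mono (ENNReal.mul_ne_top (by simp) hFt) h1
    simpa using this
  have h2' : (h : ℝ) ≤ 4294967296 * H.toReal := by
    have := ENNReal.toReal_mono (ENNReal.mul_ne_top (by simp) hHt) h2
    simpa using this
  have ha' : (a : ℝ) ≤ h := by exact_mod_cast ha
  have hb' : (b : ℝ) ≤ f := by exact_mod_cast hb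
  constructor
  · linarith
  · have : 1 - F.toReal = H.toReal := by linarith
    rw [this]
    linarith

/-! ### Checking the table -/

/-- Numerator of an upper bound for `exp (1 / j)`. -/
def expNum (j : ℕ) : ℕ :=
  36288000 * j ^ 10 + 36288000 * j ^ 9 + 18144000 * j ^ 8 + 6048000 * j ^ 7 + 1512000 * j ^ 6 +
    302400 * j ^ 5 + 50400 * j ^ 4 + 7200 * j ^ 3 + 900 * j ^ 2 + 100 * j + 11

theorem exp_le (j : ℕ) (hj : 1 ≤ j) :
    Real.exp (1 / (j : ℝ)) ≤ (expNum j : ℝ) / (36288000 * (j : ℝ) ^ 10) := by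
  have hj' : (1 : ℝ) ≤ j := by exact_mod_cast hj
  have hj0 : (j : ℝ) ≠ 0 := by positivity
  have h := Real.exp_bound' (x := 1 / (j : ℝ)) (by positivity)
    (by rw [div_le_one (by positivity)]; exact hj') (n := 10) (by norm_num)
  refine h.trans (le_of_eq ?_)
  simp only [Finset.sum_range_succ, Finset.sum_range_zero, Nat.factorial, expNum]
  push_cast
  field_simp
  ring

/-- Boolean test for a row. -/
def okRowB (j : ℕ) : ℕ → List ℕ → Bool
  | _, [] => true
  | m, q :: qs =>
    Nat.ble (q * expNum (j + 1) * ((j + 1) ^ m * Nat.factorial m))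
      (4294967296 * (36288000 * (j + 1) ^ 10)) && okRowB j (m + 1) qs

/-- Boolean test for a list of rows. -/
def okRowsB : ℕ → List (List ℕ) → Bool
  | _, [] => true
  | j, qs :: rows => okRowB j 0 qs && okRowsB (j + 1) rows

theorem okRow_of (j m : ℕ) (qs : List ℕ) (h : okRowB j m qs = true) : OkRow j m qs := by
  induction qs generalizing m with
  | nil => trivial
  | cons q qs ih =>
    rw [okRowB, Bool.and_eq_true] at h
    refine ⟨?_, ih _ h.2⟩
    have h1 := Nat.le_of_ble_eq_true h.1
    have h2 : (q : ℝ) * expNum (j + 1) * (((j : ℝ) + 1) ^ m * Nat.factorial m) ≤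
      4294967296 * (36288000 * ((j : ℝ) + 1) ^ 10) := by exact_mod_cast h1
    have he := exp_le (j + 1) (by omega)
    push_cast at he
    have hN : (0 : ℝ) < expNum (j + 1) := by
      have : 0 < expNum (j + 1) := by unfold expNum; positivity
      exact_mod_cast this
    generalize expNum (j + 1) = N at h2 he hN
    have key : (q : ℝ) / 4294967296 ≤ Real.exp (-(1 / ((j : ℕ) + 1 : ℝ))) *
        (1 / ((j : ℕ) + 1 : ℝ)) ^ m / (Nat.factorial m : ℝ) := by
      have hinv : (36288000 * ((j : ℝ) + 1) ^ 10) / (N : ℝ) ≤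
          Real.exp (-(1 / ((j : ℕ) + 1 : ℝ))) := by
        rw [Real.exp_neg, ← inv_div]
        exact inv_anti₀ (Real.exp_pos _) he
      have hf : (0 : ℝ) < Nat.factorial m := by exact_mod_cast Nat.factorial_pos m
      calc (q : ℝ) / 4294967296
          ≤ (36288000 * ((j : ℝ) + 1) ^ 10) / (N : ℝ) *
            (1 / ((j : ℕ) + 1 : ℝ)) ^ m / (Nat.factorial m : ℝ) := by
            rw [one_div, inv_pow, div_mul_eq_mul_div, div_div, ← div_eq_mul_inv, div_div,
              div_le_div_iff₀ (by norm_num) (by positivity)]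
            calc _ = (q : ℝ) * N * (((j : ℝ) + 1) ^ m * Nat.factorial m) := by ring
              _ ≤ _ := h2
              _ = _ := by ring
        _ ≤ _ := by gcongr
    unfold pois
    have h3 : ((q : ℝ≥0∞) / 4294967296) = ENNReal.ofReal ((q : ℝ) / 4294967296) := by
      rw [ENNReal.ofReal_div_of_pos (by norm_num), ENNReal.ofReal_natCast]
      norm_num
    rw [h3]
    exact ENNReal.ofReal_le_ofReal key

theorem okRows_of (j : ℕ) (rows : List (List ℕ)) (h : okRowsB j rows = true) : OkRows j rows := by
  induction rows generalizing j with
  | nil => trivial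
  | cons qs rows ih =>
    rw [okRowsB, Bool.and_eq_true] at h
    exact ⟨okRow_of _ _ _ h.1, ih _ h.2⟩

theorem okRows_take (j : ℕ) (rows : List (List ℕ)) (n : ℕ) (h : OkRows j rows) :
    OkRows j (rows.take n) := by
  induction rows generalizing j n with
  | nil => simpa using h
  | cons qs rows ih =>
    cases n with
    | zero => trivial
    | succ n => exact ⟨h.1, ih _ _ h.2⟩

theorem okTable : okRowsB 0 poisTable = true := by decide +kernel

/-- Certified fixed-point lower bounds for `pInf k` and `1 - pInf k`. -/
def Bnds (k a b : ℕ) : Prop :=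
  (b : ℝ) ≤ 4294967296 * pInf k ∧ (a : ℝ) ≤ 4294967296 * (1 - pInf k)

theorem bounds (k a b : ℕ) (hk : 1 ≤ k) (hk' : k ≤ 30)
    (hg : goodK k a b (poisTable.take k) = true) :
    Bnds k a b := by
  refine bounds_of_good k a b hk _ ?_ (okRows_take _ _ _ (okRows_of _ _ okTable)) hg
  rw [List.length_take]
  have : poisTable.length = 30 := rfl
  omega

theorem step (k a b a' b' : ℕ)
    (h : Bnds k a b)
    (h' : Bnds (k + 1) a' b')
    (hab : 4294967296 < a + b') : pInf k < pInf (k + 1) := by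
  have : (4294967296 : ℝ) < a + b' := by exact_mod_cast hab
  linarith [h.2, h'.1]

theorem bounds_1 : Bnds 1 2714900000 1580000000 :=
  bounds 1 2714900000 1580000000 (by norm_num) (by norm_num)
  (by decide +kernel)

theorem bounds_2 : Bnds 2 2378200000 1916600000 :=
  bounds 2 2378200000 1916600000 (by norm_num) (by norm_num)
  (by decide +kernel)

theorem bounds_3 : Bnds 3 2132800000 2162100000 :=
  bounds 3 2132800000 2162100000 (by norm_num) (by norm_num)
  (by decide +kernel)

theorem bounds_4 : Bnds 4 2016700000 2278200000 :=
  bounds 4 2016700000 2278200000 (by norm_num) (by norm_num)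
  (by decide +kernel)

theorem bounds_5 : Bnds 5 1896000000 2398900000 :=
  bounds 5 1896000000 2398900000 (by norm_num) (by norm_num)
  (by decide +kernel)

theorem bounds_6 : Bnds 6 1825600000 2469300000 :=
  bounds 6 1825600000 2469300000 (by norm_num) (by norm_num)
  (by decide +kernel)

theorem bounds_7 : Bnds 7 1754400000 2540500000 :=
  bounds 7 1754400000 2540500000 (by norm_num) (by norm_num)
  (by decide +kernel)

theorem bounds_8 : Bnds 8 1706200000 2588600000 :=
  bounds 8 1706200000 2588600000 (by norm_num) (by norm_num)
  (by decide +kernel)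

theorem bounds_9 : Bnds 9 1654200000 2640600000 :=
  bounds 9 1654200000 2640600000 (by norm_num) (by norm_num)
  (by decide +kernel)

theorem bounds_10 : Bnds 10 1618600000 2676300000 :=
  bounds 10 1618600000 2676300000 (by norm_num) (by norm_num)
  (by decide +kernel)

theorem bounds_11 : Bnds 11 1579300000 2715500000 :=
  bounds 11 1579300000 2715500000 (by norm_num) (by norm_num)
  (by decide +kernel)

theorem bounds_12 : Bnds 12 1551300000 2743600000 :=
  bounds 12 1551300000 2743600000 (by norm_num) (by norm_num)
  (by decide +kernel)

theorem bounds_13 : Bnds 13 1520200000 2774700000 :=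
  bounds 13 1520200000 2774700000 (by norm_num) (by norm_num)
  (by decide +kernel)

theorem bounds_14 : Bnds 14 1497000000 2797900000 :=
  bounds 14 1497000000 2797900000 (by norm_num) (by norm_num)
  (by decide +kernel)

theorem bounds_15 : Bnds 15 1471200000 2823600000 :=
  bounds 15 1471200000 2823600000 (by norm_num) (by norm_num)
  (by decide +kernel)

theorem bounds_16 : Bnds 16 1452000000 2842900000 :=
  bounds 16 1452000000 2842900000 (by norm_num) (by norm_num)
  (by decide +kernel)

theorem bounds_17 : Bnds 17 1430100000 2864800000 :=
  bounds 17 1430100000 2864800000 (by norm_num) (by norm_num)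
  (by decide +kernel)

theorem bounds_18 : Bnds 18 1413300000 2881500000 :=
  bounds 18 1413300000 2881500000 (by norm_num) (by norm_num)
  (by decide +kernel)

theorem bounds_19 : Bnds 19 1394600000 2900200000 :=
  bounds 19 1394600000 2900200000 (by norm_num) (by norm_num)
  (by decide +kernel)

theorem bounds_20 : Bnds 20 1380000000 2914800000 :=
  bounds 20 1380000000 2914800000 (by norm_num) (by norm_num)
  (by decide +kernel)

theorem bounds_21 : Bnds 21 1363600000 2931300000 :=
  bounds 21 1363600000 2931300000 (by norm_num) (by norm_num)
  (by decide +kernel)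

theorem bounds_22 : Bnds 22 1350700000 2944200000 :=
  bounds 22 1350700000 2944200000 (by norm_num) (by norm_num)
  (by decide +kernel)

theorem bounds_23 : Bnds 23 1336100000 2958700000 :=
  bounds 23 1336100000 2958700000 (by norm_num) (by norm_num)
  (by decide +kernel)

theorem bounds_24 : Bnds 24 1324600000 2970200000 :=
  bounds 24 1324600000 2970200000 (by norm_num) (by norm_num)
  (by decide +kernel)

theorem bounds_25 : Bnds 25 1311600000 2983300000 :=
  bounds 25 1311600000 2983300000 (by norm_num) (by norm_num)
  (by decide +kernel)

theorem bounds_26 : Bnds 26 1301100000 2993700000 :=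
  bounds 26 1301100000 2993700000 (by norm_num) (by norm_num)
  (by decide +kernel)

theorem bounds_27 : Bnds 27 1289400000 3005500000 :=
  bounds 27 1289400000 3005500000 (by norm_num) (by norm_num)
  (by decide +kernel)

theorem bounds_28 : Bnds 28 1279900000 3015000000 :=
  bounds 28 1279900000 3015000000 (by norm_num) (by norm_num)
  (by decide +kernel)

theorem bounds_29 : Bnds 29 1269100000 3025700000 :=
  bounds 29 1269100000 3025700000 (by norm_num) (by norm_num)
  (by decide +kernel)

theorem bounds_30 : Bnds 30 1260500000 3034400000 :=
  bounds 30 1260500000 3034400000 (by norm_num) (by norm_num)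
  (by decide +kernel)

end PInf

/-- For `1 ≤ k ≤ 29` one has `p(∞,k) < p(∞,k+1)`; equivalently `i(∞,k) > i(∞,k+1)`
(where `i(∞,k) = 1 - p(∞,k)`), so `i(∞,k)` is strictly decreasing for `k ≤ 30`. -/
theorem pInf_strictMono (k : ℕ) (hk1 : 1 ≤ k) (hk29 : k ≤ 29) :
    pInf k < pInf (k + 1) ∧ 1 - pInf (k + 1) < 1 - pInf k := by
  have key : pInf k < pInf (k + 1) := by
    interval_cases k
    · exact PInf.step 1 2714900000 1580000000 2378200000 1916600000
        PInf.bounds_1 PInf.bounds_2 (by norm_num)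
    · exact PInf.step 2 2378200000 1916600000 2132800000 2162100000
        PInf.bounds_2 PInf.bounds_3 (by norm_num)
    · exact PInf.step 3 2132800000 2162100000 2016700000 2278200000
        PInf.bounds_3 PInf.bounds_4 (by norm_num)
    · exact PInf.step 4 2016700000 2278200000 1896000000 2398900000
        PInf.bounds_4 PInf.bounds_5 (by norm_num)
    · exact PInf.step 5 1896000000 2398900000 1825600000 2469300000
        PInf.bounds_5 PInf.bounds_6 (by norm_num)
    · exact PInf.step 6 1825600000 2469300000 1754400000 2540500000
        PInf.bounds_6 PInf.bounds_7 (by norm_num)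
    · exact PInf.step 7 1754400000 2540500000 1706200000 2588600000
        PInf.bounds_7 PInf.bounds_8 (by norm_num)
    · exact PInf.step 8 1706200000 2588600000 1654200000 2640600000
        PInf.bounds_8 PInf.bounds_9 (by norm_num)
    · exact PInf.step 9 1654200000 2640600000 1618600000 2676300000
        PInf.bounds_9 PInf.bounds_10 (by norm_num)
    · exact PInf.step 10 1618600000 2676300000 1579300000 2715500000
        PInf.bounds_10 PInf.bounds_11 (by norm_num)
    · exact PInf.step 11 1579300000 2715500000 1551300000 2743600000
        PInf.bounds_11 PInf.bounds_12 (by norm_num)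
    · exact PInf.step 12 1551300000 2743600000 1520200000 2774700000
        PInf.bounds_12 PInf.bounds_13 (by norm_num)
    · exact PInf.step 13 1520200000 2774700000 1497000000 2797900000
        PInf.bounds_13 PInf.bounds_14 (by norm_num)
    · exact PInf.step 14 1497000000 2797900000 1471200000 2823600000
        PInf.bounds_14 PInf.bounds_15 (by norm_num)
    · exact PInf.step 15 1471200000 2823600000 1452000000 2842900000
        PInf.bounds_15 PInf.bounds_16 (by norm_num)
    · exact PInf.step 16 1452000000 2842900000 1430100000 2864800000
        PInf.bounds_16 PInf.bounds_17 (by norm_num)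
    · exact PInf.step 17 1430100000 2864800000 1413300000 2881500000
        PInf.bounds_17 PInf.bounds_18 (by norm_num)
    · exact PInf.step 18 1413300000 2881500000 1394600000 2900200000
        PInf.bounds_18 PInf.bounds_19 (by norm_num)
    · exact PInf.step 19 1394600000 2900200000 1380000000 2914800000
        PInf.bounds_19 PInf.bounds_20 (by norm_num)
    · exact PInf.step 20 1380000000 2914800000 1363600000 2931300000
        PInf.bounds_20 PInf.bounds_21 (by norm_num)
    · exact PInf.step 21 1363600000 2931300000 1350700000 2944200000
        PInf.bounds_21 PInf.bounds_22 (by norm_num)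
    · exact PInf.step 22 1350700000 2944200000 1336100000 2958700000
        PInf.bounds_22 PInf.bounds_23 (by norm_num)
    · exact PInf.step 23 1336100000 2958700000 1324600000 2970200000
        PInf.bounds_23 PInf.bounds_24 (by norm_num)
    · exact PInf.step 24 1324600000 2970200000 1311600000 2983300000
        PInf.bounds_24 PInf.bounds_25 (by norm_num)
    · exact PInf.step 25 1311600000 2983300000 1301100000 2993700000
        PInf.bounds_25 PInf.bounds_26 (by norm_num)
    · exact PInf.step 26 1301100000 2993700000 1289400000 3005500000
        PInf.bounds_26 PInf.bounds_27 (by norm_num)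
    · exact PInf.step 27 1289400000 3005500000 1279900000 3015000000
        PInf.bounds_27 PInf.bounds_28 (by norm_num)
    · exact PInf.step 28 1279900000 3015000000 1269100000 3025700000
        PInf.bounds_28 PInf.bounds_29 (by norm_num)
    · exact PInf.step 29 1269100000 3025700000 1260500000 3034400000
        PInf.bounds_29 PInf.bounds_30 (by norm_num)
  exact ⟨key, by linarith⟩
end

section
/- For all integers n and k with n ≤ 70, 1 ≤ k and k + 1 < n/4, the strict inequality i(n,k) > i(n,k+1) holds. -/
/-- Search trees holding pairs (mask, value). -/
inductive Tr : Type
  | e : Tr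
  | n (m p : ℕ) (l r : Tr) : Tr

/-- Tables of coefficients together with their tail sums. -/
inductive Tb : Type
  | e : Tb
  | n (c t s : ℕ) (r : Tb) : Tb

/-- Call by value for natural numbers. -/
noncomputable def force {R : Type} (x : ℕ) (f : ℕ → R) : R :=
  Nat.rec (motive := fun _ => R) (f 0) (fun m _ => f (Nat.succ m)) x

/-- Conditional. -/
noncomputable def bcase {R : Type} (b : Bool) (x y : R) : R :=
  Bool.rec (motive := fun _ => R) y x b

/-- Evaluate `x` (so that its value gets cached), then continue. -/
noncomputable def forceT {R : Type} (x : ℕ) (y : R) : R := bcase (Nat.beq x 0) y y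

/-- Insert `(m, p)`, searching along the bits of `b`, and pass the result on. -/
noncomputable def insC {R : Type} (m p : ℕ) (t : Tr) : ℕ → (Tr → R) → R :=
  Tr.rec (motive := fun _ => ℕ → (Tr → R) → R)
    (fun _ K => K (Tr.n m p Tr.e Tr.e))
    (fun m' p' l r ihl ihr b K =>
      bcase (Nat.beq m m')
        (forceT (Nat.add p p') (K (Tr.n m' (Nat.add p p') l r)))
        (bcase (Nat.beq (Nat.mod b 2) 0)
          (ihl (Nat.div b 2) fun l' => K (Tr.n m' p' l' r))
          (ihr (Nat.div b 2) fun r' => K (Tr.n m' p' l r')))) t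

noncomputable def addC {R : Type} (S q : ℕ) (acc : Tr) (K : Tr → R) : R :=
  bcase (Nat.beq q 0) (K acc) (insC S q acc (Nat.div S 2) K)

/-- All transitions out of `(S, p)`. Here `a = 2 ^ k`, `b = 2 ^ (k + 1)`. -/
noncomputable def goC {R : Type} (a b M j : ℕ) (tb : Tb) : ℕ → ℕ → Tr → (Tr → R) → R :=
  Tb.rec (motive := fun _ => ℕ → ℕ → Tr → (Tr → R) → R)
    (fun _ _ acc K => K acc)
    (fun c t s _ ih S p acc K =>
      bcase (Nat.ble a S) (K acc)
        (force (Nat.mod (Nat.lor S (Nat.shiftLeft S j)) b) fun S' =>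
          bcase (Nat.beq S S')
            (addC S (Nat.land (Nat.mul p s) M) acc K)
            (addC S (Nat.land (Nat.mul (Nat.shiftLeft p c) t) M) acc fun acc' => ih S' p acc' K))) tb

noncomputable def foldC {R : Type} (a b M j : ℕ) (tb : Tb) (t : Tr) : Tr → (Tr → R) → R :=
  Tr.rec (motive := fun _ => Tr → (Tr → R) → R)
    (fun acc K => K acc)
    (fun m p _ _ ihl ihr acc K =>
      goC a b M j tb m p acc fun acc1 => ihl acc1 fun acc2 => ihr acc2 K) t

/-- The base of the positional encoding is `2 ^ BB`. -/
def BB : ℕ := 1600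

def DD (j : ℕ) : ℕ := j ^ (70 / j) * (70 / j).factorial

def coef (j c : ℕ) : ℕ := DD j / (j ^ c * c.factorial)

/-- Build the table for the part size `j`. -/
noncomputable def mkC {R : Type} (j c : ℕ) : ℕ → Tb → (Tb → R) → R :=
  Nat.rec (motive := fun _ => ℕ → Tb → (Tb → R) → R)
    (fun s acc K => force (coef j 0) fun t => force (Nat.add t s) fun s' => K (Tb.n 0 t s' acc))
    (fun c ih s acc K =>
      force (Nat.mul BB (Nat.mul j (Nat.succ c))) fun d =>
      force (coef j (Nat.succ c)) fun t =>
        force (Nat.add (Nat.shiftLeft t d) s) fun s' => ih s' (Tb.n d t s' acc) K) c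

noncomputable def stepC {R : Type} (a b M j : ℕ) (t : Tr) (K : Tr → R) : R :=
  mkC j (70 / j) 0 Tb.e fun tb => foldC a b M j tb t Tr.e K

/-- Process the part sizes `J, J - 1, …, 1`. -/
noncomputable def runC {R : Type} (a b M J : ℕ) : Tr → (Tr → R) → R :=
  Nat.rec (motive := fun _ => Tr → (Tr → R) → R)
    (fun t K => K t)
    (fun j ih t K => stepC a b M (Nat.succ j) t fun t' => ih t' K) J

noncomputable def sumT (a : ℕ) (t : Tr) : ℕ :=
  Tr.rec (motive := fun _ => ℕ) 0
    (fun m p _ _ x y => Nat.add (bcase (Nat.ble a m) 0 p) (Nat.add x y)) t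

noncomputable def MM : ℕ := 2 ^ (BB * 71) - 1

noncomputable def valk (k : ℕ) : ℕ :=
  force (2 ^ k) fun a => force (2 ^ (k + 1)) fun b => force MM fun M =>
    runC a b M 70 (Tr.n 1 1 Tr.e Tr.e) fun t => sumT a t

noncomputable def dig (v n : ℕ) : ℕ := v / 2 ^ (BB * n) % 2 ^ BB
noncomputable def chk (u v lo i : ℕ) : Bool :=
  Nat.rec (motive := fun _ => Bool) true
    (fun i ih => bcase (Nat.blt (dig u (lo + i)) (dig v (lo + i))) ih false) i

noncomputable def chkAll (k : ℕ) : Bool :=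
  force (valk k) fun u => force (valk (k + 1)) fun v => chk u v (4 * k + 5) (66 - 4 * k)

theorem force_eq {R : Type} (x : ℕ) (f : ℕ → R) : force x f = f x := by
  cases x <;> rfl

theorem bcase_eq {R : Type} (b : Bool) (x y : R) : bcase b x y = if b = true then x else y := by
  cases b <;> rfl

theorem forceT_eq {R : Type} (x : ℕ) (y : R) : forceT x y = y := by
  unfold forceT; rw [bcase_eq]; split <;> rfl

/-- The weighted sum of the entries of a tree. -/
def tval (f : ℕ → ℕ) : Tr → ℕ
  | Tr.e => 0
  | Tr.n m p l r => p * f m + (tval f l + tval f r)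

theorem insC_spec (f : ℕ → ℕ) (m p : ℕ) (t : Tr) : ∀ b, ∃ t',
    (∀ K : Tr → ℕ, insC m p t b K = K t') ∧ tval f t' = tval f t + p * f m := by
  induction t with
  | e => intro b; exact ⟨Tr.n m p Tr.e Tr.e, fun K => rfl, by simp [tval]⟩
  | n m' p' l r ihl ihr =>
    intro b
    have unf : ∀ K : Tr → ℕ, insC m p (Tr.n m' p' l r) b K =
      bcase (Nat.beq m m')
        (forceT (Nat.add p p') (K (Tr.n m' (Nat.add p p') l r)))
        (bcase (Nat.beq (Nat.mod b 2) 0)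
          (insC m p l (Nat.div b 2) fun l' => K (Tr.n m' p' l' r))
          (insC m p r (Nat.div b 2) fun r' => K (Tr.n m' p' l r'))) := fun K => rfl
    obtain ⟨tl, hl1, hl2⟩ := ihl (Nat.div b 2)
    obtain ⟨tr, hr1, hr2⟩ := ihr (Nat.div b 2)
    by_cases h1 : Nat.beq m m' = true
    · refine ⟨Tr.n m' (Nat.add p p') l r, fun K => ?_, ?_⟩
      · rw [unf, bcase_eq, if_pos h1, forceT_eq]
      · have : m = m' := Nat.eq_of_beq_eq_true h1
        subst this
        simp only [tval, Nat.add_eq]; ring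
    · by_cases h2 : Nat.beq (Nat.mod b 2) 0 = true
      · refine ⟨Tr.n m' p' tl r, fun K => ?_, ?_⟩
        · rw [unf, bcase_eq, if_neg h1, bcase_eq, if_pos h2, hl1]
        · simp only [tval, hl2]; ring
      · refine ⟨Tr.n m' p' l tr, fun K => ?_, ?_⟩
        · rw [unf, bcase_eq, if_neg h1, bcase_eq, if_neg h2, hr1]
        · simp only [tval, hr2]; ring

theorem addC_spec (f : ℕ → ℕ) (S q : ℕ) (acc : Tr) : ∃ t',
    (∀ K : Tr → ℕ, addC S q acc K = K t') ∧ tval f t' = tval f acc + q * f S := by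
  by_cases h : Nat.beq q 0 = true
  · refine ⟨acc, fun K => ?_, ?_⟩
    · unfold addC; rw [bcase_eq, if_pos h]
    · rw [Nat.eq_of_beq_eq_true h]; simp
  · obtain ⟨t', h1, h2⟩ := insC_spec f S q acc (Nat.div S 2)
    refine ⟨t', fun K => ?_, h2⟩
    unfold addC; rw [bcase_eq, if_neg h, h1]

/-- One step on masks: adjoin a part `j`. -/
def sstep (k j S : ℕ) : ℕ := if 2 ^ k ≤ S then S else (S ||| S <<< j) % 2 ^ (k + 1)

def tbsum (k j : ℕ) (f : ℕ → ℕ) : Tb → ℕ → ℕ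
  | Tb.e, _ => 0
  | Tb.n c t _ r, S => t * 2 ^ c * f S + tbsum k j f r (sstep k j S)

def tbtot : Tb → ℕ
  | Tb.e => 0
  | Tb.n c t _ r => t * 2 ^ c + tbtot r

def tbwf : Tb → Prop
  | Tb.e => True
  | Tb.n c t s r => s = t * 2 ^ c + tbtot r ∧ tbwf r

theorem tbsum_stable (k j : ℕ) (f : ℕ → ℕ) (tb : Tb) (S : ℕ) (h : sstep k j S = S) :
    tbsum k j f tb S = tbtot tb * f S := by
  induction tb with
  | e => simp [tbsum, tbtot]
  | n c t s r ih => simp only [tbsum, tbtot, h, ih]; ring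

theorem goC_spec (k j e : ℕ) (f : ℕ → ℕ) (hf : ∀ S, 2 ^ k ≤ S → f S = 0) (p : ℕ) (tb : Tb) :
    tbwf tb → ∀ S acc, ∃ t',
    (∀ K : Tr → ℕ, goC (2 ^ k) (2 ^ (k + 1)) (2 ^ e - 1) j tb S p acc K = K t') ∧
    tval f t' ≡ tval f acc + p * tbsum k j f tb S [MOD 2 ^ e] := by
  induction tb with
  | e => intro _ S acc; exact ⟨acc, fun K => rfl, by simp [tbsum, Nat.ModEq.refl]⟩
  | n c t s r ih =>
    intro hwf S acc
    have unf : ∀ K : Tr → ℕ, goC (2 ^ k) (2 ^ (k + 1)) (2 ^ e - 1) j (Tb.n c t s r) S p acc K =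
      bcase (Nat.ble (2 ^ k) S) (K acc)
        (force (Nat.mod (Nat.lor S (Nat.shiftLeft S j)) (2 ^ (k + 1))) fun S' =>
          bcase (Nat.beq S S')
            (addC S (Nat.land (Nat.mul p s) (2 ^ e - 1)) acc K)
            (addC S (Nat.land (Nat.mul (Nat.shiftLeft p c) t) (2 ^ e - 1)) acc fun acc' =>
              goC (2 ^ k) (2 ^ (k + 1)) (2 ^ e - 1) j r S' p acc' K)) := fun K => rfl
    have hland : ∀ x, Nat.land x (2 ^ e - 1) = x % 2 ^ e := fun x => Nat.and_two_pow_sub_one_eq_mod x e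
    by_cases h1 : Nat.ble (2 ^ k) S = true
    · refine ⟨acc, fun K => ?_, ?_⟩
      · rw [unf, bcase_eq, if_pos h1]
      · have hS : 2 ^ k ≤ S := Nat.le_of_ble_eq_true h1
        have : sstep k j S = S := by simp [sstep, hS]
        rw [tbsum_stable _ _ _ _ _ this, hf S hS]; simp [Nat.ModEq.refl]
    · have hS : ¬ 2 ^ k ≤ S := fun h => h1 (Nat.ble_eq_true_of_le h)
      have hst : Nat.mod (Nat.lor S (Nat.shiftLeft S j)) (2 ^ (k + 1)) = sstep k j S := by
        unfold sstep; rw [if_neg hS]; rfl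
      by_cases h2 : Nat.beq S (sstep k j S) = true
      · obtain ⟨t', ht1, ht2⟩ := addC_spec f S (Nat.land (Nat.mul p s) (2 ^ e - 1)) acc
        refine ⟨t', fun K => ?_, ?_⟩
        · rw [unf, bcase_eq, if_neg h1, force_eq, hst, bcase_eq, if_pos h2, ht1]
        · rw [ht2, hland, tbsum_stable _ _ _ _ _ (Nat.eq_of_beq_eq_true h2).symm]
          have : s = tbtot (Tb.n c t s r) := hwf.1
          rw [← this, ← mul_assoc]
          exact Nat.ModEq.add_left _ ((Nat.mod_modEq _ _).mul_right _)
      · obtain ⟨t1, ht1, ht2⟩ :=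
          addC_spec f S (Nat.land (Nat.mul (Nat.shiftLeft p c) t) (2 ^ e - 1)) acc
        obtain ⟨t2, hu1, hu2⟩ := ih hwf.2 (sstep k j S) t1
        refine ⟨t2, fun K => ?_, ?_⟩
        · rw [unf, bcase_eq, if_neg h1, force_eq, hst, bcase_eq, if_neg h2, ht1, hu1]
        · refine hu2.trans ?_
          rw [ht2, hland]
          have hsh : Nat.shiftLeft p c = p * 2 ^ c := Nat.shiftLeft_eq p c
          have : tval f acc + p * tbsum k j f (Tb.n c t s r) S =
            tval f acc + (p * 2 ^ c * t) * f S + p * tbsum k j f r (sstep k j S) := by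
            simp only [tbsum]; ring
          rw [this, hsh]
          exact Nat.ModEq.add_right _ (Nat.ModEq.add_left _ ((Nat.mod_modEq _ _).mul_right _))

theorem foldC_spec (k j e : ℕ) (f : ℕ → ℕ) (hf : ∀ S, 2 ^ k ≤ S → f S = 0) (tb : Tb)
    (hwf : tbwf tb) (t : Tr) : ∀ acc, ∃ t',
    (∀ K : Tr → ℕ, foldC (2 ^ k) (2 ^ (k + 1)) (2 ^ e - 1) j tb t acc K = K t') ∧
    tval f t' ≡ tval f acc + tval (tbsum k j f tb) t [MOD 2 ^ e] := by
  induction t with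
  | e => intro acc; exact ⟨acc, fun K => rfl, by simp [tval, Nat.ModEq.refl]⟩
  | n m p l r ihl ihr =>
    intro acc
    obtain ⟨t1, ha1, ha2⟩ := goC_spec k j e f hf p tb hwf m acc
    obtain ⟨t2, hb1, hb2⟩ := ihl t1
    obtain ⟨t3, hc1, hc2⟩ := ihr t2
    refine ⟨t3, fun K => ?_, ?_⟩
    · have unf : foldC (2 ^ k) (2 ^ (k + 1)) (2 ^ e - 1) j tb (Tr.n m p l r) acc K =
        goC (2 ^ k) (2 ^ (k + 1)) (2 ^ e - 1) j tb m p acc fun acc1 =>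
          foldC (2 ^ k) (2 ^ (k + 1)) (2 ^ e - 1) j tb l acc1 fun acc2 =>
          foldC (2 ^ k) (2 ^ (k + 1)) (2 ^ e - 1) j tb r acc2 K := rfl
      rw [unf, ha1, hb1, hc1]
    · refine hc2.trans ((hb2.add_right _).trans (((ha2.add_right _).add_right _).trans ?_))
      simp only [tval, add_assoc, Nat.ModEq.refl]

theorem mkC_spec (k j : ℕ) (f : ℕ → ℕ) (c : ℕ) : ∀ s acc, tbwf acc → s = tbtot acc → ∃ tb,
    (∀ K : Tb → ℕ, mkC j c s acc K = K tb) ∧ tbwf tb ∧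
    ∀ S, tbsum k j f tb S =
      ∑ i ∈ Finset.range (c + 1), coef j i * 2 ^ (BB * (j * i)) * f ((sstep k j)^[i] S) +
        tbsum k j f acc ((sstep k j)^[c + 1] S) := by
  induction c with
  | zero =>
    intro s acc hw hs
    refine ⟨Tb.n 0 (coef j 0) (coef j 0 + s) acc, fun K => ?_, ⟨by simp [hs], hw⟩, fun S => ?_⟩
    · have unf : mkC j 0 s acc K =
        force (coef j 0) fun t => force (Nat.add t s) fun s' => K (Tb.n 0 t s' acc) := rfl
      rw [unf, force_eq, force_eq]; rfl
    · simp [tbsum]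
  | succ c ih =>
    intro s acc hw hs
    have hsh : ∀ p c, Nat.shiftLeft p c = p * 2 ^ c := fun p c => Nat.shiftLeft_eq p c
    obtain ⟨tb, h1, h2, h3⟩ := ih (coef j (c + 1) * 2 ^ (BB * (j * (c + 1))) + s)
      (Tb.n (BB * (j * (c + 1))) (coef j (c + 1)) (coef j (c + 1) * 2 ^ (BB * (j * (c + 1))) + s) acc)
      ⟨by rw [hs], hw⟩ (by rw [hs]; rfl)
    refine ⟨tb, fun K => ?_, h2, fun S => ?_⟩
    · have unf : mkC j (c + 1) s acc K =
        force (Nat.mul BB (Nat.mul j (Nat.succ c))) fun d =>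
        force (coef j (Nat.succ c)) fun t =>
        force (Nat.add (Nat.shiftLeft t d) s) fun s' => mkC j c s' (Tb.n d t s' acc) K := rfl
      rw [unf, force_eq, force_eq, force_eq, hsh]
      exact h1 K
    · rw [h3, Finset.sum_range_succ _ (c + 1), tbsum, add_assoc, ← Function.iterate_succ_apply' (sstep k j)]

/-- The generating polynomial of the good configurations. -/
noncomputable def Wp (k : ℕ) : ℕ → ℕ → Polynomial ℕ
  | 0, S => if 2 ^ k ≤ S then 0 else 1
  | j + 1, S => ∑ i ∈ Finset.range (70 / (j + 1) + 1),
      Polynomial.C (coef (j + 1) i) * Polynomial.X ^ ((j + 1) * i) * Wp k j ((sstep k (j + 1))^[i] S)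

noncomputable def Wv (k j S : ℕ) : ℕ := (Wp k j S).eval (2 ^ BB)

theorem Wv_succ (k j S : ℕ) : Wv k (j + 1) S = ∑ i ∈ Finset.range (70 / (j + 1) + 1),
    coef (j + 1) i * 2 ^ (BB * ((j + 1) * i)) * Wv k j ((sstep k (j + 1))^[i] S) := by
  simp only [Wv, Wp, Polynomial.eval_finsetSum, Polynomial.eval_mul, Polynomial.eval_C,
    Polynomial.eval_pow, Polynomial.eval_X, ← pow_mul]

theorem sstep_iter_ge (k j S i : ℕ) (h : 2 ^ k ≤ S) : (sstep k j)^[i] S = S := by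
  have : sstep k j S = S := by simp [sstep, h]
  exact Function.iterate_fixed this i

theorem Wp_zero (k j : ℕ) : ∀ S, 2 ^ k ≤ S → Wp k j S = 0 := by
  induction j with
  | zero => intro S h; simp [Wp, h]
  | succ j ih =>
    intro S h
    rw [Wp]
    refine Finset.sum_eq_zero fun i _ => ?_
    rw [sstep_iter_ge _ _ _ _ h, ih S h, mul_zero]

theorem Wv_zero (k j S : ℕ) (h : 2 ^ k ≤ S) : Wv k j S = 0 := by
  rw [Wv, Wp_zero _ _ _ h, Polynomial.eval_zero]

theorem stepC_spec (k j e : ℕ) (t : Tr) : ∃ t',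
    (∀ K : Tr → ℕ, stepC (2 ^ k) (2 ^ (k + 1)) (2 ^ e - 1) (j + 1) t K = K t') ∧
    tval (Wv k j) t' ≡ tval (Wv k (j + 1)) t [MOD 2 ^ e] := by
  obtain ⟨tb, h1, h2, h3⟩ := mkC_spec k (j + 1) (Wv k j) (70 / (j + 1)) 0 Tb.e trivial rfl
  obtain ⟨t', g1, g2⟩ := foldC_spec k (j + 1) e (Wv k j) (Wv_zero k j) tb h2 t Tr.e
  refine ⟨t', fun K => ?_, g2.trans ?_⟩
  · unfold stepC; rw [h1, g1]
  · have : tbsum k (j + 1) (Wv k j) tb = Wv k (j + 1) := by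
      funext S; rw [h3, Wv_succ]; simp [tbsum]
    rw [this]; simp [tval, Nat.ModEq.refl]

theorem runC_spec (k e J : ℕ) : ∀ t, ∃ t',
    (∀ K : Tr → ℕ, runC (2 ^ k) (2 ^ (k + 1)) (2 ^ e - 1) J t K = K t') ∧
    tval (Wv k 0) t' ≡ tval (Wv k J) t [MOD 2 ^ e] := by
  induction J with
  | zero => intro t; exact ⟨t, fun K => rfl, Nat.ModEq.refl _⟩
  | succ j ih =>
    intro t
    obtain ⟨t1, h1, h2⟩ := stepC_spec k j e t
    obtain ⟨t2, g1, g2⟩ := ih t1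
    refine ⟨t2, fun K => ?_, g2.trans h2⟩
    have unf : runC (2 ^ k) (2 ^ (k + 1)) (2 ^ e - 1) (j + 1) t K =
      stepC (2 ^ k) (2 ^ (k + 1)) (2 ^ e - 1) (j + 1) t fun t' =>
        runC (2 ^ k) (2 ^ (k + 1)) (2 ^ e - 1) j t' K := rfl
    rw [unf, h1, g1]

theorem sumT_eq (k : ℕ) (t : Tr) : sumT (2 ^ k) t = tval (Wv k 0) t := by
  induction t with
  | e => rfl
  | n m p l r ihl ihr =>
    have unf : sumT (2 ^ k) (Tr.n m p l r) =
      (bcase (Nat.ble (2 ^ k) m) 0 p) + (sumT (2 ^ k) l + sumT (2 ^ k) r) := rfl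
    rw [unf, ihl, ihr, tval, bcase_eq]
    congr 1
    by_cases h : 2 ^ k ≤ m
    · rw [if_pos (Nat.ble_eq_true_of_le h), Wv_zero _ _ _ h, mul_zero]
    · rw [if_neg (fun h' => h (Nat.le_of_ble_eq_true h'))]
      simp [Wv, Wp, h]

theorem valk_spec (k : ℕ) : valk k ≡ (Wp k 70 1).eval (2 ^ BB) [MOD 2 ^ (BB * 71)] := by
  obtain ⟨t, h1, h2⟩ := runC_spec k (BB * 71) 70 (Tr.n 1 1 Tr.e Tr.e)
  unfold valk MM
  rw [force_eq, force_eq, force_eq, h1, sumT_eq]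
  refine h2.trans ?_
  simp [tval, Wv, Nat.ModEq.refl]

theorem digit_eq (x : ℕ) (hx : 0 < x) (n : ℕ) : ∀ (P : Polynomial ℕ) (v : ℕ),
    (∀ i ≤ n, P.coeff i < x) → v ≡ P.eval x [MOD x ^ (n + 1)] → v / x ^ n % x = P.coeff n := by
  induction n with
  | zero =>
    intro P v h hv
    have h0 : P.eval x = P.divX.eval x * x + P.coeff 0 := by
      conv_lhs => rw [← Polynomial.divX_mul_X_add P]
      simp
    rw [h0] at hv
    simp only [zero_add, pow_one] at hv
    have := hv.trans (show P.divX.eval x * x + P.coeff 0 ≡ P.coeff 0 [MOD x] by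
      simp [Nat.ModEq])
    simp only [pow_zero, Nat.div_one]
    rw [this, Nat.mod_eq_of_lt (h 0 le_rfl)]
  | succ n ih =>
    intro P v h hv
    have h0 : P.eval x = P.divX.eval x * x + P.coeff 0 := by
      conv_lhs => rw [← Polynomial.divX_mul_X_add P]
      simp
    have hm : v % x = P.coeff 0 := by
      have h1 : v ≡ P.eval x [MOD x] := hv.of_dvd (dvd_pow_self x (by omega))
      rw [h0] at h1
      have := h1.trans (show P.divX.eval x * x + P.coeff 0 ≡ P.coeff 0 [MOD x] by
        simp [Nat.ModEq])
      rw [this, Nat.mod_eq_of_lt (h 0 (by omega))]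
    have h2 : v / x ≡ P.divX.eval x [MOD x ^ (n + 1)] := by
      have h3 : v = x * (v / x) + P.coeff 0 := by rw [← hm, Nat.div_add_mod]
      rw [h0, mul_comm] at hv
      rw [h3] at hv
      have h4 := Nat.ModEq.add_right_cancel' _ hv
      rw [pow_succ' x (n + 1)] at h4
      exact Nat.ModEq.mul_left_cancel' hx.ne' h4
    have := ih P.divX (v / x) (fun i hi => by
      rw [Polynomial.coeff_divX]; exact h _ (by omega)) h2
    rw [Polynomial.coeff_divX] at this
    rw [← this, Nat.div_div_eq_div_mul, pow_succ']

theorem dig_eq (k n : ℕ) (hn : n ≤ 70) (h : ∀ i ≤ 70, (Wp k 70 1).coeff i < 2 ^ BB) :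
    dig (valk k) n = (Wp k 70 1).coeff n := by
  unfold dig
  rw [pow_mul]
  refine digit_eq _ (by positivity) n _ _ (fun i hi => h i (by omega)) ?_
  refine (valk_spec k).of_dvd ?_
  rw [pow_mul]
  exact pow_dvd_pow _ (by omega)

theorem chk_spec (u v lo i : ℕ) (h : chk u v lo i = true) :
    ∀ x < i, dig u (lo + x) < dig v (lo + x) := by
  induction i with
  | zero => intro x hx; omega
  | succ i ih =>
    have unf : chk u v lo (i + 1) =
      bcase (Nat.blt (dig u (lo + i)) (dig v (lo + i))) (chk u v lo i) false := rfl
    rw [unf, bcase_eq] at h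
    split_ifs at h with h1
    intro x hx
    rcases Nat.lt_succ_iff_lt_or_eq.mp hx with h2 | rfl
    · exact ih h x h2
    · exact Nat.le_of_ble_eq_true h1

theorem chkAll_spec (k n : ℕ) (h : chkAll k = true) (h1 : 4 * k + 5 ≤ n) (h2 : n ≤ 70) :
    dig (valk k) n < dig (valk (k + 1)) n := by
  unfold chkAll at h
  rw [force_eq, force_eq] at h
  have := chk_spec _ _ _ _ h (n - (4 * k + 5)) (by omega)
  rwa [Nat.add_sub_cancel' h1] at this

/-- `i` is the sum of a submultiset of `m`. -/
def SubSum (i : ℕ) (m : Multiset ℕ) : Prop := ∃ s ≤ m, s.sum = i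

theorem SubSum_zero (i : ℕ) : SubSum i 0 ↔ i = 0 := by
  unfold SubSum
  constructor
  · rintro ⟨s, hs, rfl⟩
    have : s = 0 := Multiset.le_zero.mp hs
    simp [this]
  · rintro rfl; exact ⟨0, le_rfl, rfl⟩

theorem SubSum_cons (i j : ℕ) (m : Multiset ℕ) :
    SubSum i (j ::ₘ m) ↔ SubSum i m ∨ (j ≤ i ∧ SubSum (i - j) m) := by
  unfold SubSum
  simp only [← Multiset.mem_powerset, Multiset.powerset_cons, Multiset.mem_add, Multiset.mem_map]
  constructor
  · rintro ⟨s, hs | ⟨t, ht, rfl⟩, h⟩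
    · exact Or.inl ⟨s, hs, h⟩
    · rw [Multiset.sum_cons] at h
      exact Or.inr ⟨by omega, t, ht, by omega⟩
  · rintro (⟨s, hs, h⟩ | ⟨hj, t, ht, h⟩)
    · exact ⟨s, Or.inl hs, h⟩
    · exact ⟨j ::ₘ t, Or.inr ⟨t, ht, rfl⟩, by rw [Multiset.sum_cons]; omega⟩

/-- The mask `S` represents the multiset `m`. -/
def MaskRep (k S : ℕ) (m : Multiset ℕ) : Prop :=
  (SubSum k m ∧ 2 ^ k ≤ S) ∨
    (¬ SubSum k m ∧ S < 2 ^ k ∧ ∀ i < k, (S.testBit i = true ↔ SubSum i m))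

theorem MaskRep_one (k : ℕ) (hk : 1 ≤ k) : MaskRep k 1 0 := by
  refine Or.inr ⟨by rw [SubSum_zero]; omega, Nat.one_lt_two_pow (by omega), fun i _ => ?_⟩
  rw [SubSum_zero, Nat.testBit_one_eq_true_iff_self_eq_zero]

theorem MaskRep_step (k j S : ℕ) (m : Multiset ℕ) (h : MaskRep k S m) :
    MaskRep k (sstep k j S) (j ::ₘ m) := by
  rcases h with ⟨h1, h2⟩ | ⟨h1, h2, h3⟩
  · refine Or.inl ⟨(SubSum_cons _ _ _).mpr (Or.inl h1), ?_⟩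
    simp [sstep, h2]
  · have hS : sstep k j S = (S ||| S <<< j) % 2 ^ (k + 1) := by simp [sstep, h2]
    have hlt : sstep k j S < 2 ^ (k + 1) := by rw [hS]; exact Nat.mod_lt _ (by positivity)
    have h4 : ∀ i ≤ k, (S.testBit i = true ↔ SubSum i m) := by
      intro i hi
      rcases Nat.lt_or_eq_of_le hi with h | rfl
      · exact h3 i h
      · simp [h1, Nat.testBit_lt_two_pow h2]
    have h5 : ∀ i ≤ k, ((sstep k j S).testBit i = true ↔ SubSum i (j ::ₘ m)) := by
      intro i hi
      rw [hS, SubSum_cons, Nat.testBit_mod_two_pow, Nat.testBit_or, Nat.testBit_shiftLeft]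
      have e1 := h4 i hi
      have e2 := h4 (i - j) (by omega)
      have : i < k + 1 := by omega
      simp [this, ← e1, ← e2]
    by_cases hk : SubSum k (j ::ₘ m)
    · exact Or.inl ⟨hk, Nat.ge_two_pow_of_testBit ((h5 k le_rfl).mpr hk)⟩
    · refine Or.inr ⟨hk, ?_, fun i hi => h5 i hi.le⟩
      apply Nat.lt_pow_two_of_testBit
      intro i hi
      rcases Nat.lt_or_eq_of_le hi with h | rfl
      · exact Nat.testBit_lt_two_pow (lt_of_lt_of_le hlt (Nat.pow_le_pow_right (by norm_num) h))
      · have := h5 k le_rfl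
        simpa [hk] using this

theorem MaskRep_iter (k j i : ℕ) : ∀ (S : ℕ) (m : Multiset ℕ), MaskRep k S m →
    MaskRep k ((sstep k j)^[i] S) (m + Multiset.replicate i j) := by
  induction i with
  | zero => intro S m h; simpa using h
  | succ i ih =>
    intro S m h
    rw [Function.iterate_succ_apply', Multiset.replicate_succ, Multiset.add_cons]
    exact MaskRep_step _ _ _ _ (ih S m h)

/-- The order of the centralizer of a permutation with given cycle lengths. -/
def zz (m : Multiset ℕ) : ℕ := m.prod * ∏ i ∈ m.toFinset, (m.count i).factorial

theorem zz_eq (m : Multiset ℕ) (T : Finset ℕ) (h : m.toFinset ⊆ T) :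
    zz m = m.prod * ∏ i ∈ T, (m.count i).factorial := by
  unfold zz
  congr 1
  refine Finset.prod_subset h fun x _ hx => ?_
  rw [Multiset.mem_toFinset] at hx
  rw [Multiset.count_eq_zero_of_notMem hx, Nat.factorial_zero]

theorem zz_add (c j : ℕ) (m : Multiset ℕ) (h : j ∉ m) :
    zz (Multiset.replicate c j + m) = j ^ c * c.factorial * zz m := by
  have hj : j ∉ m.toFinset := by simpa using h
  rw [zz_eq _ (insert j m.toFinset), zz, Finset.prod_insert hj, Multiset.prod_add,
    Multiset.prod_replicate, Multiset.count_add, Multiset.count_replicate_self,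
    Multiset.count_eq_zero_of_notMem h]
  · have : ∏ x ∈ m.toFinset, ((Multiset.replicate c j + m).count x).factorial =
      ∏ x ∈ m.toFinset, (m.count x).factorial := by
      refine Finset.prod_congr rfl fun x hx => ?_
      have : j ≠ x := fun h => hj (h ▸ hx)
      rw [Multiset.count_add, Multiset.count_replicate, if_neg this, zero_add]
    rw [this, add_zero]; ring
  · intro x hx
    simp only [Multiset.toFinset_add, Finset.mem_union, Multiset.mem_toFinset,
      Multiset.mem_replicate, Finset.mem_insert] at hx ⊢
    tauto

/-- Multisets with parts in `{1, …, J}` and sum `n ≤ 70`. -/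
def Ms : ℕ → ℕ → Finset (Multiset ℕ)
  | 0, n => if n = 0 then {0} else ∅
  | J + 1, n => ((Finset.range (70 / (J + 1) + 1)).filter (fun c => (J + 1) * c ≤ n)).biUnion
      fun c => (Ms J (n - (J + 1) * c)).image fun m => Multiset.replicate c (J + 1) + m

theorem mem_Ms (J : ℕ) : ∀ n ≤ 70, ∀ m : Multiset ℕ,
    m ∈ Ms J n ↔ (∀ x ∈ m, 1 ≤ x ∧ x ≤ J) ∧ m.sum = n := by
  induction J with
  | zero =>
    intro n _ m
    have : (∀ x ∈ m, 1 ≤ x ∧ x ≤ 0) ↔ m = 0 := by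
      constructor
      · intro h
        refine Multiset.eq_zero_of_forall_notMem fun x hx => ?_
        have := h x hx; omega
      · rintro rfl; simp
    rw [this, Ms]
    split_ifs with hn
    · rw [Finset.mem_singleton]
      constructor
      · rintro rfl; simp [hn]
      · exact fun h => h.1
    · simp only [Finset.notMem_empty, false_iff]
      rintro ⟨rfl, h⟩
      exact hn (by simpa using h.symm)
  | succ J ih =>
    intro n hn m
    simp only [Ms, Finset.mem_biUnion, Finset.mem_filter, Finset.mem_range, Finset.mem_image]
    constructor
    · rintro ⟨c, ⟨hc, hcn⟩, m', hm', rfl⟩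
      obtain ⟨h1, h2⟩ := (ih _ (by omega) m').mp hm'
      refine ⟨fun x hx => ?_, ?_⟩
      · rw [Multiset.mem_add] at hx
        rcases hx with hx | hx
        · rw [Multiset.eq_of_mem_replicate hx]; omega
        · have := h1 x hx; omega
      · rw [Multiset.sum_add, Multiset.sum_replicate, h2, smul_eq_mul, mul_comm]; omega
    · rintro ⟨h1, h2⟩
      have hsplit : Multiset.replicate (m.count (J + 1)) (J + 1) + m.filter (fun x => ¬ J + 1 = x) = m := by
        rw [← Multiset.filter_eq, Multiset.filter_add_not]
      have hsum : (J + 1) * m.count (J + 1) + (m.filter (fun x => ¬ J + 1 = x)).sum = n := by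
        rw [← h2]
        conv_rhs => rw [← hsplit]
        rw [Multiset.sum_add, Multiset.sum_replicate, smul_eq_mul, mul_comm]
      refine ⟨m.count (J + 1), ⟨?_, by omega⟩, m.filter (fun x => ¬ J + 1 = x), ?_, hsplit⟩
      · rw [Nat.lt_succ_iff, Nat.le_div_iff_mul_le (by omega), mul_comm]; omega
      · refine (ih _ (by omega) _).mpr ⟨fun x hx => ?_, by omega⟩
        rw [Multiset.mem_filter] at hx
        have := h1 x hx.1
        omega

theorem sum_Ms (J n : ℕ) (hn : n ≤ 70) (F : Multiset ℕ → ℚ) :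
    ∑ m ∈ Ms (J + 1) n, F m = ∑ c ∈ Finset.range (70 / (J + 1) + 1),
      if (J + 1) * c ≤ n then
        ∑ m ∈ Ms J (n - (J + 1) * c), F (Multiset.replicate c (J + 1) + m) else 0 := by
  have hcount : ∀ c, ∀ m ∈ Ms J (n - (J + 1) * c),
      (Multiset.replicate c (J + 1) + m).count (J + 1) = c := by
    intro c m hm
    have := ((mem_Ms J _ (by omega) m).mp hm).1
    have h : J + 1 ∉ m := fun h => by have := this _ h; omega
    rw [Multiset.count_add, Multiset.count_replicate_self, Multiset.count_eq_zero_of_notMem h,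
      add_zero]
  rw [Ms, Finset.sum_biUnion, Finset.sum_filter]
  · refine Finset.sum_congr rfl fun c _ => ?_
    split_ifs
    · rw [Finset.sum_image]
      intro x _ y _ hxy
      exact add_left_cancel hxy
    · rfl
  · intro c _ c' _ hcc
    rw [Function.onFun, Finset.disjoint_left]
    intro m hm hm'
    rw [Finset.mem_image] at hm hm'
    obtain ⟨a, ha, rfl⟩ := hm
    obtain ⟨b, hb, hab⟩ := hm'
    apply hcc
    rw [← hcount c a ha, ← hab, hcount c' b hb]

open Classical in
/-- Indicator of the multisets without submultiset of sum `k`. -/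
noncomputable def ind (k : ℕ) (m : Multiset ℕ) : ℚ := if SubSum k m then 0 else 1

def scale (J : ℕ) : ℕ := ∏ i ∈ Finset.range J, DD (i + 1)

theorem scale_succ (J : ℕ) : scale (J + 1) = scale J * DD (J + 1) := by
  unfold scale; rw [Finset.prod_range_succ]

theorem coef_cast (j c : ℕ) (hc : c ≤ 70 / (j + 1)) :
    (coef (j + 1) c : ℚ) = DD (j + 1) * ((((j + 1) ^ c * c.factorial : ℕ) : ℚ))⁻¹ := by
  unfold coef
  rw [Nat.cast_div, div_eq_mul_inv]
  · exact Nat.mul_dvd_mul (pow_dvd_pow _ hc) (Nat.factorial_dvd_factorial hc)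
  · have := Nat.factorial_pos c
    positivity

theorem coeff_spec (k J : ℕ) : ∀ (n S : ℕ) (m0 : Multiset ℕ), MaskRep k S m0 → n ≤ 70 →
    ((Wp k J S).coeff n : ℚ) = scale J * ∑ m ∈ Ms J n, ((zz m : ℕ) : ℚ)⁻¹ * ind k (m0 + m) := by
  induction J with
  | zero =>
    intro n S m0 h hn
    simp only [Wp, Ms, scale, Finset.prod_range_zero]
    rcases h with ⟨h1, h2⟩ | ⟨h1, h2, _⟩
    · simp only [h2, if_true, Polynomial.coeff_zero]
      split_ifs <;> simp [ind, h1]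
    · rw [if_neg (by omega), Polynomial.coeff_one]
      split_ifs with hn0 <;> simp_all [ind, zz]
  | succ J ih =>
    intro n S m0 h hn
    rw [sum_Ms J n hn, Wp, Polynomial.finsetSum_coeff, Nat.cast_sum, Finset.mul_sum]
    refine Finset.sum_congr rfl fun c hc => ?_
    rw [Finset.mem_range, Nat.lt_succ_iff] at hc
    rw [mul_assoc, Polynomial.coeff_C_mul, Polynomial.coeff_X_pow_mul']
    split_ifs with hle
    · rw [Nat.cast_mul, ih _ _ _ (MaskRep_iter k (J + 1) c S m0 h) (by omega), coef_cast J c hc,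
        scale_succ, Nat.cast_mul, Finset.mul_sum, Finset.mul_sum,
        Finset.mul_sum]
      refine Finset.sum_congr rfl fun m hm => ?_
      have hm1 := ((mem_Ms J _ (by omega) m).mp hm).1
      have hnot : J + 1 ∉ m := fun h => by have := hm1 _ h; omega
      rw [zz_add _ _ _ hnot, add_assoc]
      push_cast
      ring
    · simp

attribute [irreducible] Ms Wp valk scale

section perms
open Equiv.Perm

variable {α : Type} [Fintype α] [DecidableEq α]

theorem cycleType_glue (S : Finset α) (σ : Equiv.Perm {x // x ∈ S}) (τ : Equiv.Perm {x // ¬ x ∈ S}) :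
    (ofSubtype σ * ofSubtype τ).cycleType = σ.cycleType + τ.cycleType := by
  have hd : Equiv.Perm.Disjoint (ofSubtype σ) (ofSubtype τ) := by
    intro x
    by_cases hx : x ∈ S
    · right; exact ofSubtype_apply_of_not_mem τ (by simpa using hx)
    · left; exact ofSubtype_apply_of_not_mem σ hx
  rw [hd.cycleType_mul, cycleType_ofSubtype, cycleType_ofSubtype]

theorem cycleType_sum_le (σ : Equiv.Perm α) : σ.cycleType.sum ≤ Fintype.card α := by
  rw [sum_cycleType]; exact Finset.card_le_univ _

theorem parts_eq (σ : Equiv.Perm α) : σ.partition.parts =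
    σ.cycleType + Multiset.replicate (Fintype.card α - σ.cycleType.sum) 1 := by
  rw [parts_partition, sum_cycleType]

theorem subSum_of_fix (k : ℕ) (π : Equiv.Perm α) (S : Finset α) (hk : S.card = k)
    (hS : S.image π = S) : SubSum k π.partition.parts := by
  have h1 : ∀ x, π x ∈ S ↔ x ∈ S := by
    intro x
    conv_lhs => rw [← hS]
    simp
  have h2 : ∀ x, ¬ π x ∈ S ↔ ¬ x ∈ S := fun x => not_congr (h1 x)
  set σ := π.subtypePerm (p := fun x => x ∈ S) h1 with hσ
  set τ := π.subtypePerm (p := fun x => ¬ x ∈ S) h2 with hτ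
  have hπ : ofSubtype σ * ofSubtype τ = π := by
    ext x
    rw [mul_apply]
    by_cases hx : x ∈ S
    · rw [ofSubtype_apply_of_not_mem τ (by simpa using hx), ofSubtype_apply_of_mem σ hx]
      rfl
    · rw [ofSubtype_apply_of_mem τ hx, ofSubtype_apply_of_not_mem σ]
      · rfl
      · simpa [hτ] using (h1 x).not.mpr hx
  have hc := cycleType_glue S σ τ
  rw [hπ] at hc
  have e1 := cycleType_sum_le σ
  have e2 := cycleType_sum_le τ
  have c1 : Fintype.card {x // x ∈ S} = k := by simpa using hk
  have c2 : Fintype.card {x // ¬ x ∈ S} = Fintype.card α - k := by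
    rw [Fintype.card_subtype_compl, c1]
  rw [c1] at e1
  rw [c2] at e2
  have hkle : k ≤ Fintype.card α := hk ▸ Finset.card_le_univ S
  refine ⟨σ.cycleType + Multiset.replicate (k - σ.cycleType.sum) 1, ?_, ?_⟩
  · rw [parts_eq, hc]
    refine add_le_add (Multiset.le_add_right _ _) ?_
    rw [Multiset.replicate_le_replicate, Multiset.sum_add]
    omega
  · rw [Multiset.sum_add, Multiset.sum_replicate, smul_eq_mul]; omega

theorem filter_sum_le (s : Multiset ℕ) (p : ℕ → Prop) [DecidablePred p] :
    (s.filter p).sum ≤ s.sum := by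
  conv_rhs => rw [← Multiset.filter_add_not p s, Multiset.sum_add]
  omega

theorem fix_of_subSum (k : ℕ) (π : Equiv.Perm α) (h : SubSum k π.partition.parts) :
    ∃ S : Finset α, S.card = k ∧ S.image π = S := by
  obtain ⟨s, hs, hsum⟩ := h
  obtain ⟨u, hu⟩ := Multiset.le_iff_exists_add.mp hs
  have hct := filter_parts_partition_eq_cycleType (σ := π)
  have htot := π.partition.parts_sum
  rw [hu, Multiset.sum_add, hsum] at htot
  rw [hu, Multiset.filter_add] at hct
  obtain ⟨S, _, hS⟩ := Finset.exists_subset_card_eq (s := (Finset.univ : Finset α)) (n := k)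
    (by rw [Finset.card_univ]; omega)
  have c1 : Fintype.card {x // x ∈ S} = k := by simpa using hS
  have c2 : Fintype.card {x // ¬ x ∈ S} = Fintype.card α - k := by
    rw [Fintype.card_subtype_compl, c1]
  obtain ⟨σ, hσ⟩ := (exists_with_cycleType_iff {x // x ∈ S} (m := s.filter (2 ≤ ·))).mpr
    ⟨by rw [c1, ← hsum]; exact filter_sum_le _ _, fun a ha => (Multiset.mem_filter.mp ha).2⟩
  obtain ⟨τ, hτ⟩ := (exists_with_cycleType_iff {x // ¬ x ∈ S} (m := u.filter (2 ≤ ·))).mpr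
    ⟨by rw [c2]; exact (filter_sum_le _ _).trans (by omega),
      fun a ha => (Multiset.mem_filter.mp ha).2⟩
  have hc := cycleType_glue S σ τ
  rw [hσ, hτ, hct] at hc
  obtain ⟨g, hg⟩ := isConj_iff.mp (isConj_of_cycleType_eq hc)
  have hρ : ∀ x ∈ S, (ofSubtype σ * ofSubtype τ) x ∈ S := by
    intro x hx
    rw [mul_apply, ofSubtype_apply_of_not_mem τ (by simpa using hx), ofSubtype_apply_of_mem σ hx]
    exact (σ ⟨x, hx⟩).2
  refine ⟨S.image g, ?_, ?_⟩
  · rw [Finset.card_image_of_injective _ g.injective, hS]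
  · apply Finset.eq_of_subset_of_card_le
    · intro y hy
      simp only [Finset.mem_image] at hy ⊢
      obtain ⟨z, ⟨x, hx, rfl⟩, rfl⟩ := hy
      refine ⟨_, hρ x hx, ?_⟩
      rw [← hg]
      simp
    · rw [Finset.card_image_of_injective _ π.injective]

theorem fiber_card (n : ℕ) (m : Multiset ℕ) (hpos : ∀ x ∈ m, 1 ≤ x) (hsum : m.sum = n)
    (hα : Fintype.card α = n) :
    (Finset.univ.filter fun π : Equiv.Perm α => π.partition.parts = m).card * zz m = n.factorial := by
  have hone : m.filter (fun x => ¬ 2 ≤ x) = Multiset.replicate (m.count 1) 1 := by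
    rw [← Multiset.filter_eq]
    refine Multiset.filter_congr fun x hx => ?_
    have := hpos x hx
    omega
  have hsplit : Multiset.replicate (m.count 1) 1 + m.filter (2 ≤ ·) = m := by
    rw [← hone, add_comm, Multiset.filter_add_not]
  have hs2 : m.count 1 + (m.filter (2 ≤ ·)).sum = n := by
    rw [← hsum]
    conv_rhs => rw [← hsplit]
    simp
  have hset : (Finset.univ.filter fun π : Equiv.Perm α => π.partition.parts = m) =
      Finset.univ.filter fun π : Equiv.Perm α => π.cycleType = m.filter (2 ≤ ·) := by
    ext π
    simp only [Finset.mem_filter, Finset.mem_univ, true_and]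
    constructor
    · rintro rfl
      exact filter_parts_partition_eq_cycleType.symm
    · intro h
      rw [parts_eq, h, hα]
      conv_rhs => rw [← hsplit]
      rw [add_comm]
      congr 2
      omega
  have key := card_of_cycleType_mul_eq α (m.filter (2 ≤ ·))
  rw [if_pos ⟨by omega, fun a ha => (Multiset.mem_filter.mp ha).2⟩, hα] at key
  rw [hset, ← key]
  congr 1
  conv_lhs => rw [← hsplit]
  rw [zz_add _ _ _ (by simp), one_pow, one_mul, zz, mul_assoc]
  congr 2
  omega

end perms

/-- The proportion of permutations not fixing a `k`-set. -/
noncomputable def TT (n k : ℕ) : ℚ := ∑ m ∈ Ms 70 n, ((zz m : ℕ) : ℚ)⁻¹ * ind k m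

open Classical in
theorem nofix_card (n k : ℕ) (hn : n ≤ 70) :
    ((Finset.univ.filter fun π : Equiv.Perm (Fin n) => ¬ SubSum k π.partition.parts).card : ℚ) =
      n.factorial * TT n k := by
  have hmaps : ∀ π ∈ Finset.univ.filter
      (fun π : Equiv.Perm (Fin n) => ¬ SubSum k π.partition.parts),
      π.partition.parts ∈ Ms 70 n := by
    intro π _
    have hs : π.partition.parts.sum = n := by simpa using π.partition.parts_sum
    refine (mem_Ms 70 n hn _).mpr ⟨fun x hx => ⟨π.partition.parts_pos hx, ?_⟩, hs⟩
    have := Multiset.single_le_sum (fun _ _ => Nat.zero_le _) x hx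
    omega
  rw [Finset.card_eq_sum_card_fiberwise hmaps, Nat.cast_sum, TT, Finset.mul_sum]
  refine Finset.sum_congr rfl fun m hm => ?_
  obtain ⟨h1, h2⟩ := (mem_Ms 70 n hn m).mp hm
  have hf := fiber_card (α := Fin n) n m (fun x hx => (h1 x hx).1) h2 (by simp)
  have hz : (zz m : ℚ) ≠ 0 := by
    intro h
    have h0 : zz m = 0 := by exact_mod_cast h
    rw [h0, mul_zero] at hf
    exact (Nat.factorial_pos n).ne hf
  rw [Finset.filter_filter]
  by_cases hk : SubSum k m
  · simp only [ind, hk, if_true, mul_zero]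
    rw [Nat.cast_eq_zero, Finset.card_eq_zero, Finset.filter_eq_empty_iff]
    rintro π _ ⟨h3, rfl⟩
    exact h3 hk
  · simp only [ind, hk, if_false, mul_one]
    rw [← hf, Nat.cast_mul, mul_assoc, mul_inv_cancel₀ hz, mul_one]
    congr 2
    ext π
    simp only [Finset.mem_filter, Finset.mem_univ, true_and]
    constructor
    · exact fun h => h.2
    · rintro rfl; exact ⟨hk, rfl⟩

theorem TT_le_one (n k : ℕ) (hn : n ≤ 70) : TT n k ≤ 1 := by
  classical
  have h := nofix_card n k hn
  have h1 : (Finset.univ.filter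
      fun π : Equiv.Perm (Fin n) => ¬ SubSum k π.partition.parts).card ≤ n.factorial := by
    refine (Finset.card_le_univ _).trans ?_
    rw [Fintype.card_perm, Fintype.card_fin]
  have h2 : (n.factorial : ℚ) * TT n k ≤ n.factorial * 1 := by
    rw [mul_one]; rw [← h]; exact_mod_cast h1
  exact le_of_mul_le_mul_left h2 (by exact_mod_cast Nat.factorial_pos n)

theorem fixProp_eq_s15 (n k : ℕ) (hn : n ≤ 70) : fixProp n k = 1 - ((TT n k : ℚ) : ℝ) := by
  classical
  have h := nofix_card n k hn
  have hadd := Finset.card_filter_add_card_filter_not (s := Finset.univ)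
    (fun π : Equiv.Perm (Fin n) => SubSum k π.partition.parts)
  have hcn : (Finset.univ : Finset (Equiv.Perm (Fin n))).card = n.factorial := by
    rw [Finset.card_univ, Fintype.card_perm, Fintype.card_fin]
  rw [hcn] at hadd
  have hcard : Nat.card {π : Equiv.Perm (Fin n) //
      ∃ S : Finset (Fin n), S.card = k ∧ S.image π = S} =
      (Finset.univ.filter fun π : Equiv.Perm (Fin n) => SubSum k π.partition.parts).card := by
    rw [Nat.card_eq_fintype_card, Fintype.card_subtype]
    congr 1
    ext π
    simp only [Finset.mem_filter, Finset.mem_univ, true_and]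
    exact ⟨fun ⟨S, h1, h2⟩ => subSum_of_fix k π S h1 h2, fix_of_subSum k π⟩
  have hfac : (n.factorial : ℝ) ≠ 0 := by exact_mod_cast (Nat.factorial_pos n).ne'
  unfold fixProp
  rw [hcard, div_eq_iff hfac]
  have h' : (((Finset.univ.filter
      fun π : Equiv.Perm (Fin n) => ¬ SubSum k π.partition.parts).card : ℕ) : ℝ) =
      n.factorial * ((TT n k : ℚ) : ℝ) := by exact_mod_cast congrArg (fun q : ℚ => (q : ℝ)) h
  have hadd' := congrArg (fun x : ℕ => (x : ℝ)) hadd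
  simp only [Nat.cast_add] at hadd'
  linarith

theorem coeff_TT (n k : ℕ) (hn : n ≤ 70) (hk : 1 ≤ k) :
    ((Wp k 70 1).coeff n : ℚ) = scale 70 * TT n k := by
  rw [coeff_spec k 70 n 1 0 (MaskRep_one k hk) hn, TT]
  simp only [zero_add]

theorem scale_lt : scale 70 < 2 ^ BB := by
  unfold scale; decide +kernel

theorem dig_TT (n k : ℕ) (hn : n ≤ 70) (hk : 1 ≤ k) :
    (dig (valk k) n : ℚ) = scale 70 * TT n k := by
  rw [dig_eq k n hn, coeff_TT n k hn hk]
  intro i hi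
  have h1 := coeff_TT i k hi hk
  have h2 := TT_le_one i k hi
  have h3 : ((Wp k 70 1).coeff i : ℚ) ≤ scale 70 := by
    rw [h1]; exact mul_le_of_le_one_right (Nat.cast_nonneg _) h2
  have h4 : (Wp k 70 1).coeff i ≤ scale 70 := by exact_mod_cast h3
  exact lt_of_le_of_lt h4 scale_lt

theorem chkAll_1 : chkAll 1 = true := by decide +kernel

theorem chkAll_2 : chkAll 2 = true := by decide +kernel

theorem chkAll_3 : chkAll 3 = true := by decide +kernel

theorem chkAll_4 : chkAll 4 = true := by decide +kernel

theorem chkAll_5 : chkAll 5 = true := by decide +kernel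

theorem chkAll_6 : chkAll 6 = true := by decide +kernel

theorem chkAll_7 : chkAll 7 = true := by decide +kernel

theorem chkAll_8 : chkAll 8 = true := by decide +kernel

theorem chkAll_9 : chkAll 9 = true := by decide +kernel

theorem chkAll_10 : chkAll 10 = true := by decide +kernel

theorem chkAll_11 : chkAll 11 = true := by decide +kernel

theorem chkAll_12 : chkAll 12 = true := by decide +kernel

theorem chkAll_13 : chkAll 13 = true := by decide +kernel

theorem chkAll_14 : chkAll 14 = true := by decide +kernel

theorem chkAll_15 : chkAll 15 = true := by decide +kernel

theorem chkAll_16 : chkAll 16 = true := by decide +kernel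

theorem chkAll_true (k : ℕ) (h1 : 1 ≤ k) (h2 : k ≤ 16) : chkAll k = true := by
  have h : k = 1 ∨ k = 2 ∨ k = 3 ∨ k = 4 ∨ k = 5 ∨ k = 6 ∨ k = 7 ∨ k = 8 ∨ k = 9 ∨ k = 10 ∨
    k = 11 ∨ k = 12 ∨ k = 13 ∨ k = 14 ∨ k = 15 ∨ k = 16 := by omega
  rcases h with rfl | rfl | rfl | rfl | rfl | rfl | rfl | rfl | rfl | rfl | rfl | rfl | rfl |
    rfl | rfl | rfl
  · exact chkAll_1
  · exact chkAll_2
  · exact chkAll_3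
  · exact chkAll_4
  · exact chkAll_5
  · exact chkAll_6
  · exact chkAll_7
  · exact chkAll_8
  · exact chkAll_9
  · exact chkAll_10
  · exact chkAll_11
  · exact chkAll_12
  · exact chkAll_13
  · exact chkAll_14
  · exact chkAll_15
  · exact chkAll_16

/-- For all `n ≤ 70` and `k ≥ 1` with `k + 1 < n/4`, one has `i(n,k) > i(n,k+1)`. -/
theorem fixProp_decreasing (n k : ℕ) (hn : n ≤ 70) (hk : 1 ≤ k)
    (hk4 : (k : ℝ) + 1 < (n : ℝ) / 4) :
    fixProp n (k + 1) < fixProp n k := by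
  have h4 : 4 * k + 5 ≤ n := by
    have h : (4 * k + 4 : ℝ) < n := by linarith
    have h' : 4 * k + 4 < n := by exact_mod_cast h
    omega
  have hd := chkAll_spec k n (chkAll_true k hk (by omega)) h4 hn
  have e1 := dig_TT n k hn hk
  have e2 := dig_TT n (k + 1) hn (by omega)
  have hq : (dig (valk k) n : ℚ) < dig (valk (k + 1)) n := by exact_mod_cast hd
  rw [e1, e2] at hq
  have hT : TT n k < TT n (k + 1) := lt_of_mul_lt_mul_left hq (Nat.cast_nonneg _)
  rw [fixProp_eq_s15 n k hn, fixProp_eq_s15 n (k + 1) hn]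
  have hR : ((TT n k : ℚ) : ℝ) < ((TT n (k + 1) : ℚ) : ℝ) := by exact_mod_cast hT
  linarith
end
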